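/- If M, N, P ≥ 5 are all odd integers, then the Artin group A_{MNP} is residually finite. -/

import Mathlib

/-- The alternating word (a,b)_M = abab⋯ of length M in the free group. -/
def altWord {V : Type} (a b : V) (M : ℕ) : FreeGroup V :=
  ((List.range M).map fun i => if i % 2 = 0 then FreeGroup.of a else FreeGroup.of b).prod

/-- The relators of the Artin group A_{MNP} on three generators a = 0, b = 1, c = 2. -/
def artinRels3 (M N P : ℕ) : Set (FreeGroup (Fin 3)) :=
  {altWord 0 1 M * (altWord 1 0 M)⁻¹,
   altWord 1 2 N * (altWord 2 1 N)⁻¹,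
   altWord 2 0 P * (altWord 0 2 P)⁻¹}

/-- The Artin group A_{MNP}. -/
abbrev Artin3 (M N P : ℕ) : Type := PresentedGroup (artinRels3 M N P)

/-- A group is residually finite if every nontrivial element survives in some finite quotient. -/
def ResiduallyFinite (G : Type*) [Group G] : Prop :=
  ∀ g : G, g ≠ 1 → ∃ (Q : Type) (_ : Group Q) (_ : Finite Q) (φ : G →* Q), φ g ≠ 1

/-! ### Free groups are residually finite -/

theorem exists_perm_of_rel {X : Type} [Finite X] (R : X → X → Prop)
    (hf : ∀ u v v', R u v → R u v' → v = v') (hi : ∀ u u' v, R u v → R u' v → u = u') :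
    ∃ π : Equiv.Perm X, ∀ u v, R u v → π u = v := by
  classical
  have key : ∀ x : {u // ∃ v, R u v}, ∃ y : {v // ∃ u, R u v}, R x.1 y.1 := by
    rintro ⟨u, v, h⟩
    exact ⟨⟨v, u, h⟩, h⟩
  choose F hF using key
  have hb : Function.Bijective F := by
    constructor
    · intro x y hxy
      apply Subtype.ext
      apply hi _ _ _ (hF x)
      rw [hxy]; exact hF y
    · rintro ⟨v, u, h⟩
      refine ⟨⟨u, v, h⟩, ?_⟩
      apply Subtype.ext
      exact hf _ _ _ (hF ⟨u, v, h⟩) h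
  refine ⟨(Equiv.ofBijective F hb).extendSubtype, ?_⟩
  intro u v h
  rw [Equiv.extendSubtype_apply_of_mem _ u ⟨v, h⟩]
  exact hf _ _ _ (hF ⟨u, v, h⟩) h

theorem freeGroup_rf {α : Type} (g : FreeGroup α) (hg : g ≠ 1) :
    ∃ (Q : Type) (_ : Group Q) (_ : Finite Q) (φ : FreeGroup α →* Q), φ g ≠ 1 := by
  classical
  set L := g.toWord with hL
  have hred : ∀ i, ∀ (h : i + 1 < L.length), L[i].1 = L[i+1].1 → L[i].2 = L[i+1].2 := by
    have := FreeGroup.isReduced_toWord (x := g)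
    rw [FreeGroup.IsReduced, List.isChain_iff_getElem] at this
    intro i h
    exact this i h
  set n := L.length with hn
  let R : α → Fin (n+1) → Fin (n+1) → Prop := fun s u v =>
    ∃ i, ∃ h : i < L.length, L[i].1 = s ∧
      ((L[i].2 = true ∧ u.1 = i + 1 ∧ v.1 = i) ∨ (L[i].2 = false ∧ u.1 = i ∧ v.1 = i + 1))
  have hR : ∀ s, ∃ π : Equiv.Perm (Fin (n+1)), ∀ u v, R s u v → π u = v := by
    intro s
    apply exists_perm_of_rel
    · rintro u v v' ⟨i, hi, hs, h1⟩ ⟨j, hj, hs', h2⟩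
      apply Fin.ext
      rcases h1 with ⟨a1, a2, a3⟩ | ⟨a1, a2, a3⟩ <;> rcases h2 with ⟨b1, b2, b3⟩ | ⟨b1, b2, b3⟩
      · omega
      · exfalso
        obtain rfl : j = i + 1 := by omega
        have := hred i hj (by rw [hs, hs'])
        rw [a1, b1] at this
        exact absurd this (by decide)
      · exfalso
        obtain rfl : i = j + 1 := by omega
        have := hred j hi (by rw [hs, hs'])
        rw [a1, b1] at this
        exact absurd this (by decide)
      · omega
    · rintro v v' u ⟨i, hi, hs, h1⟩ ⟨j, hj, hs', h2⟩
      apply Fin.ext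
      rcases h1 with ⟨a1, a2, a3⟩ | ⟨a1, a2, a3⟩ <;> rcases h2 with ⟨b1, b2, b3⟩ | ⟨b1, b2, b3⟩
      · omega
      · exfalso
        obtain rfl : i = j + 1 := by omega
        have := hred j hi (by rw [hs, hs'])
        rw [a1, b1] at this
        exact absurd this (by decide)
      · exfalso
        obtain rfl : j = i + 1 := by omega
        have := hred i hj (by rw [hs, hs'])
        rw [a1, b1] at this
        exact absurd this (by decide)
      · omega
  choose π hπ using hR
  refine ⟨Equiv.Perm (Fin (n+1)), inferInstance, inferInstance, FreeGroup.lift π, ?_⟩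
  have main : ∀ k, ∀ (hk : k ≤ L.length),
      FreeGroup.lift π (FreeGroup.mk (L.drop (n - k))) (Fin.last n) = ⟨n - k, by omega⟩ := by
    intro k
    induction k with
    | zero =>
      intro _
      have : L.drop (n - 0) = [] := by simp [hn]
      rw [this, ← FreeGroup.one_eq_mk, map_one]
      rfl
    | succ k ih =>
      intro hk
      have hlt : n - (k+1) < L.length := by omega
      have e1 : L.drop (n - (k+1)) = [L[n-(k+1)]] ++ L.drop (n - k) := by
        rw [List.drop_eq_getElem_cons hlt]
        have : n - (k+1) + 1 = n - k := by omega
        rw [this]; rfl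
      rw [e1, ← FreeGroup.mul_mk, map_mul, Equiv.Perm.mul_apply, ih (by omega)]
      rcases hb : (L[n-(k+1)]).2 with _ | _
      · have e2 : FreeGroup.mk [L[n-(k+1)]] = (FreeGroup.of (L[n-(k+1)]).1)⁻¹ := by
          rw [FreeGroup.of, FreeGroup.inv_mk]
          simp only [FreeGroup.invRev, List.map_cons, List.map_nil, List.reverse_singleton,
            Bool.not_true, ← hb]
        rw [e2, map_inv, FreeGroup.lift_apply_of, Equiv.Perm.inv_eq_iff_eq]
        symm
        apply hπ
        exact ⟨n-(k+1), hlt, rfl, Or.inr ⟨hb, rfl, by simp; omega⟩⟩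
      · have e2 : FreeGroup.mk [L[n-(k+1)]] = (FreeGroup.of (L[n-(k+1)]).1) := by
          rw [FreeGroup.of, ← hb]
        rw [e2, FreeGroup.lift_apply_of]
        apply hπ
        exact ⟨n-(k+1), hlt, rfl, Or.inl ⟨hb, by simp; omega, rfl⟩⟩
  intro h1
  have h2 := main n le_rfl
  have e : FreeGroup.mk (L.drop (n - n)) = g := by simp [hL, FreeGroup.mk_toWord]
  rw [e, h1] at h2
  have h3 : n = 0 := by
    have := congrArg Fin.val h2
    simpa using this
  apply hg
  rw [← FreeGroup.toWord_eq_nil_iff]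
  exact List.length_eq_zero_iff.mp h3

/-! ### Residual finiteness criterion for an amalgam with an index two edge group -/

section Criterion

/-- The word `ι (s 0) δ ι (s 1) δ ⋯ δ ι (s k)`. -/
def wordOf {G A : Type} [Group G] [Group A] (ι : A →* G) (δ : G) (s : ℕ → A) : ℕ → G
  | 0 => ι (s 0)
  | k + 1 => wordOf ι δ s k * δ * ι (s (k + 1))

theorem wordOf_congr {G A : Type} [Group G] [Group A] (ι : A →* G) (δ : G) (s s' : ℕ → A) (k : ℕ)
    (h : ∀ i ≤ k, s i = s' i) : wordOf ι δ s k = wordOf ι δ s' k := by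
  induction k with
  | zero => simp [wordOf, h 0 le_rfl]
  | succ k ih =>
    rw [wordOf, wordOf, ih (fun i hi => h i (by omega)), h (k+1) le_rfl]

variable {G A C : Type} [Group G] [Group A] [Group C]

/-- `g` has a reduced expression. -/
def IsRed (ι : A →* G) (γ : C →* A) (δ : G) (g : G) : Prop :=
  ∃ (k : ℕ) (s : ℕ → A), (∀ i, 0 < i → i < k → s i ∉ γ.range) ∧ g = wordOf ι δ s k

theorem isRed_mul_ι {ι : A →* G} {γ : C →* A} {δ g : G} (h : IsRed ι γ δ g) (a : A) :
    IsRed ι γ δ (g * ι a) := by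
  classical
  obtain ⟨k, s, hs, rfl⟩ := h
  refine ⟨k, Function.update s k (s k * a), ?_, ?_⟩
  · intro i h1 h2
    rw [Function.update_of_ne (by omega)]
    exact hs i h1 h2
  · cases k with
    | zero => simp [wordOf]
    | succ k =>
      rw [wordOf, wordOf, Function.update_self, map_mul,
        wordOf_congr ι δ (Function.update s (k+1) (s (k+1) * a)) s k]
      · group
      · intro i hi
        rw [Function.update_of_ne (by omega)]

theorem isRed_mul_δ {ι : A →* G} {γ : C →* A} {β : C →* C} {d : C} {δ : G}
    (hδ2 : δ * δ = ι (γ d)) (hδ : ∀ c, δ * ι (γ c) = ι (γ (β c)) * δ)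
    {g : G} (h : IsRed ι γ δ g) : IsRed ι γ δ (g * δ) := by
  classical
  obtain ⟨k, s, hs, rfl⟩ := h
  by_cases hk : 0 < k ∧ s k ∈ γ.range
  · obtain ⟨hk, c, hc⟩ := hk
    obtain ⟨k, rfl⟩ : ∃ j, k = j + 1 := ⟨k - 1, by omega⟩
    have : wordOf ι δ s (k+1) * δ = wordOf ι δ s k * ι (γ (β c * d)) := by
      rw [wordOf, ← hc, mul_assoc, mul_assoc, ← mul_assoc δ, hδ, mul_assoc (ι _), hδ2, map_mul,
        map_mul]
    rw [this]
    apply isRed_mul_ι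
    exact ⟨k, s, fun i h1 h2 => hs i h1 (by omega), rfl⟩
  · refine ⟨k + 1, Function.update s (k+1) 1, ?_, ?_⟩
    · intro i h1 h2
      rw [Function.update_of_ne (by omega)]
      rcases Nat.lt_succ_iff_lt_or_eq.mp h2 with h | h
      · exact hs i h1 h
      · subst h
        exact fun h => hk ⟨h1, h⟩
    · rw [wordOf, Function.update_self, map_one, mul_one]
      congr 1
      apply wordOf_congr
      intro i hi
      rw [Function.update_of_ne (by omega)]

theorem isRed_all {ι : A →* G} {γ : C →* A} {β : C →* C} {d : C} {δ : G}
    (hδ2 : δ * δ = ι (γ d)) (hδ : ∀ c, δ * ι (γ c) = ι (γ (β c)) * δ)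
    (hgen : Subgroup.closure (Set.range ι ∪ {δ}) = ⊤) (g : G) : IsRed ι γ δ g := by
  have hg : g ∈ Subgroup.closure (Set.range ι ∪ {δ}) := by rw [hgen]; trivial
  induction hg using Subgroup.closure_induction_right with
  | one => exact ⟨0, fun _ => 1, by intros; omega, by simp [wordOf]⟩
  | mul_right x hx y hy ih =>
    rcases hy with ⟨a, rfl⟩ | hy
    · exact isRed_mul_ι ih a
    · rw [Set.mem_singleton_iff] at hy
      subst hy
      exact isRed_mul_δ hδ2 hδ ih
  | mul_inv_cancel x hx y hy ih =>
    rcases hy with ⟨a, rfl⟩ | hy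
    · rw [← map_inv]
      exact isRed_mul_ι ih _
    · rw [Set.mem_singleton_iff] at hy
      subst hy
      have : y⁻¹ = y * ι (γ d)⁻¹ := by
        rw [map_inv, ← hδ2]; group
      rw [this, ← mul_assoc]
      exact isRed_mul_ι (isRed_mul_δ hδ2 hδ ih) _

end Criterion

section Criterion2

variable {G A C : Type} [Group G] [Group A] [Group C]

/-- The key permutation representation detecting a reduced word. -/
theorem exists_perm_rep {Q : Type} [Group Q] [Finite Q] (φ : A →* Q) (γ : C →* A) (β : C →* C)
    (d : C) (hβd : β d = d) (hββ : ∀ c, β (β c) = d * c * d⁻¹)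
    (hβ : ∀ c, φ (γ c) = 1 → φ (γ (β c)) = 1) (k : ℕ) (s : ℕ → A)
    (hs : ∀ i, 0 < i → i < k → φ (s i) ∉ (φ.comp γ).range) :
    ∃ (Ω : Type) (_ : Finite Ω) (j : A →* Equiv.Perm Ω) (D : Equiv.Perm Ω),
      D * D = j (γ d) ∧ (∀ c, D * j (γ c) = j (γ (β c)) * D) ∧
      (∀ a, j a = 1 → φ a = 1) ∧
      ∃ (pt : A → ℕ → Bool → Ω) (lev : Ω → ℕ),
        (∀ a i b, i ≤ k → lev (pt a i b) = i) ∧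
        (∀ a i b, i ≤ k → j a (pt a⁻¹ i b) = pt 1 i b) ∧
        (∀ i b, i < k → D (pt 1 (i+1) b) = pt (s i)⁻¹ i (!b)) := by
  classical
  set R : Subgroup Q := (φ.comp γ).range with hR
  let mk : C →* R := (φ.comp γ).rangeRestrict
  have mk_val : ∀ c, ((mk c : R) : Q) = φ (γ c) := fun c => rfl
  have mk_surj : Function.Surjective mk := MonoidHom.rangeRestrict_surjective _
  have hmk : ∀ c c', mk c = mk c' → mk (β c) = mk (β c') := by
    intro c c' h
    have h1 : φ (γ (c * c'⁻¹)) = 1 := by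
      rw [← mk_val, map_mul, map_inv, h]; simp
    have h2 := hβ _ h1
    apply Subtype.ext
    rw [mk_val, mk_val]
    simpa [mul_inv_eq_one] using h2
  choose lft hlft using mk_surj
  let bb : R → R := fun r => mk (β (lft r))
  have hbb : ∀ c, bb (mk c) = mk (β c) := fun c => hmk _ _ (hlft _)
  let O := Quotient (QuotientGroup.rightRel R)
  let cls : Q → O := fun q => Quotient.mk _ q
  have hcls : ∀ q q', cls q = cls q' ↔ q' * q⁻¹ ∈ R := by
    intro q q'
    show (Quotient.mk _ q : O) = Quotient.mk _ q' ↔ _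
    rw [Quotient.eq, QuotientGroup.rightRel_apply]
  let sec : Fin (k+1) → Bool → O → Q := fun i b o =>
    if o = cls 1 ∧ 0 < i.1 then 1 else if o = cls (φ (s i.1))⁻¹ then
      (if b then (1 : Q) else ((mk d)⁻¹ : R)) * (φ (s i.1))⁻¹ else o.out
  have hsec : ∀ i b o, cls (sec i b o) = o := by
    intro i b o
    simp only [sec]
    split_ifs with h1 h2 h3
    · exact h1.1.symm
    · rw [one_mul]; exact h2.symm
    · rw [h2, hcls]
      simp
    · exact Quotient.out_eq o
  have hne : ∀ i, 0 < i → i < k → cls (φ (s i))⁻¹ ≠ cls 1 := by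
    intro i h1 h2 h
    rw [hcls] at h
    apply hs i h1 h2
    simpa using h
  let τ : O × Fin (k+1) → O × Fin (k+1) := fun w =>
    if h : w.1 = cls 1 ∧ 0 < w.2.1 then
      (cls (φ (s (w.2.1 - 1)))⁻¹, ⟨w.2.1 - 1, by omega⟩)
    else if h : w.1 = cls (φ (s w.2.1))⁻¹ ∧ w.2.1 < k then (cls 1, ⟨w.2.1 + 1, by omega⟩)
    else w
  have hττ : ∀ w, τ (τ w) = w := by
    rintro ⟨o, i, hi⟩
    by_cases h1 : o = cls 1 ∧ 0 < i
    · have e1 : τ (o, ⟨i, hi⟩) = (cls (φ (s (i - 1)))⁻¹, ⟨i - 1, by omega⟩) := by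
        simp only [τ]; rw [dif_pos h1]
      rw [e1]
      simp only [τ]
      rw [dif_neg, dif_pos]
      · obtain ⟨rfl, h1⟩ := h1
        have : i - 1 + 1 = i := by omega
        simp only [this]
      · refine ⟨trivial, ?_⟩
        show i - 1 < k
        omega
      · rintro ⟨h2, h3⟩
        exact hne (i-1) h3 (by omega) h2
    · by_cases h2 : o = cls (φ (s i))⁻¹ ∧ i < k
      · have e1 : τ (o, ⟨i, hi⟩) = (cls 1, ⟨i + 1, by omega⟩) := by
          simp only [τ]; rw [dif_neg h1, dif_pos h2]
        rw [e1]
        simp only [τ]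
        rw [dif_pos (by exact ⟨trivial, Nat.succ_pos i⟩)]
        obtain ⟨rfl, h2⟩ := h2
        rfl
      · have e1 : τ (o, ⟨i, hi⟩) = (o, ⟨i, hi⟩) := by
          simp only [τ]; rw [dif_neg h1, dif_neg h2]
        rw [e1, e1]
  let X := (O × Fin (k+1)) × Bool
  let e0 : R × X → Q × (Fin (k+1) × Bool) := fun y =>
    ((y.1 : Q) * sec y.2.1.2 y.2.2 y.2.1.1, (y.2.1.2, y.2.2))
  have he0 : Function.Bijective e0 := by
    constructor
    · rintro ⟨r, ⟨o, i⟩, b⟩ ⟨r', ⟨o', i'⟩, b'⟩ h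
      simp only [e0, Prod.mk.injEq] at h
      obtain ⟨h1, rfl, rfl⟩ := h
      have h2 : o = o' := by
        rw [← hsec i b o, ← hsec i b o', hcls]
        have : sec i b o' * (sec i b o)⁻¹ = ((r'⁻¹ * r : R) : Q) := by
          push_cast
          rw [eq_inv_mul_iff_mul_eq, ← mul_assoc, ← h1]
          group
        rw [this]
        exact (r'⁻¹ * r).2
      subst h2
      have := mul_right_cancel h1
      simp [Subtype.ext this]
    · rintro ⟨q, i, b⟩
      have h : q * (sec i b (cls q))⁻¹ ∈ R := by
        rw [← hcls, hsec]
      refine ⟨(⟨_, h⟩, ((cls q, i), b)), ?_⟩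
      simp [e0]
  let e := Equiv.ofBijective e0 he0
  let D0 : R × X → R × X := fun y =>
    (bb y.1 * (if y.2.2 then mk d else 1), (τ y.2.1, !y.2.2))
  have hDD0 : ∀ r x, D0 (D0 (r, x)) = (mk d * r, x) := by
    rintro r ⟨w, b⟩
    obtain ⟨c, rfl⟩ : ∃ c, mk c = r := ⟨_, hlft r⟩
    cases b
    · simp only [D0]
      simp only [Bool.false_eq_true, if_false, mul_one, hbb, hββ, hττ, Bool.not_false, if_true,
        Bool.not_true, map_mul, map_inv, inv_mul_cancel_right]
    · simp only [D0]
      simp only [Bool.false_eq_true, if_false, mul_one, hbb, Bool.not_true, if_true,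
        Bool.not_false, hττ, ← map_mul]
      rw [map_mul β, hββ, hβd]
      simp
  have hD0 : Function.Bijective D0 := by
    constructor
    · rintro ⟨r, x⟩ ⟨r', x'⟩ h
      have := congrArg D0 h
      rw [hDD0, hDD0] at this
      simpa using this
    · rintro ⟨r, x⟩
      refine ⟨D0 ((mk d)⁻¹ * r, x), ?_⟩
      rw [hDD0]; simp
  have hD0c : ∀ c r x, D0 (mk c * r, x) = (mk (β c) * (D0 (r, x)).1, (D0 (r, x)).2) := by
    intro c r x
    obtain ⟨c', rfl⟩ : ∃ c', mk c' = r := ⟨_, hlft r⟩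
    simp only [D0]
    rw [← map_mul, hbb, hbb, map_mul, map_mul, mul_assoc]
  let D : Equiv.Perm (Q × (Fin (k+1) × Bool)) := (e.symm.trans (Equiv.ofBijective D0 hD0)).trans e
  have hDe : ∀ y, D (e y) = e (D0 y) := by
    intro y
    simp [D]
  let j : A →* Equiv.Perm (Q × (Fin (k+1) × Bool)) :=
    { toFun := fun a => Equiv.prodCongr (Equiv.mulLeft (φ a)) (Equiv.refl _)
      map_one' := by ext ⟨q, x⟩ <;> simp
      map_mul' := by
        intro a a'
        ext ⟨q, x⟩ <;> simp [mul_assoc] }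
  have hj : ∀ a q x, j a (q, x) = (φ a * q, x) := fun a q x => rfl
  have hje : ∀ c r x, j (γ c) (e (r, x)) = e (mk c * r, x) := by
    intro c r x
    show j (γ c) (e0 (r, x)) = e0 (mk c * r, x)
    simp only [e0]
    rw [hj, ← mk_val]
    push_cast
    rw [mul_assoc]
  refine ⟨Q × (Fin (k+1) × Bool), inferInstance, j, D, ?_, ?_, ?_, ?_⟩
  · apply Equiv.ext
    intro y
    obtain ⟨⟨r, x⟩, rfl⟩ := e.surjective y
    rw [Equiv.Perm.mul_apply, hDe, hDe, hDD0, hje]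
  · intro c
    apply Equiv.ext
    intro y
    obtain ⟨⟨r, x⟩, rfl⟩ := e.surjective y
    rw [Equiv.Perm.mul_apply, Equiv.Perm.mul_apply, hje, hDe, hDe, hD0c, hje]
  · intro a ha
    have h := hj a 1 (0, true)
    rw [ha, mul_one] at h
    exact (congrArg Prod.fst h).symm
  · refine ⟨fun a i b => (φ a, (Fin.ofNat (k+1) i, b)), fun y => y.2.1.1, ?_, ?_, ?_⟩
    · intro a i b hi
      show i % (k+1) = i
      exact Nat.mod_eq_of_lt (by omega)
    · intro a i b hi
      simp [hj]
    · intro i b hi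
      have f1 : Fin.ofNat (k+1) i = ⟨i, by omega⟩ := Fin.ext (Nat.mod_eq_of_lt (by omega))
      have f2 : Fin.ofNat (k+1) (i+1) = ⟨i+1, by omega⟩ := Fin.ext (Nat.mod_eq_of_lt (by omega))
      show D (φ 1, (Fin.ofNat (k+1) (i+1), b)) = (φ (s i)⁻¹, (Fin.ofNat (k+1) i, !b))
      rw [f1, f2, map_one, map_inv]
      have g1 : ((1, (⟨i+1, by omega⟩, b)) : Q × (Fin (k+1) × Bool))
          = e (1, ((cls 1, ⟨i+1, by omega⟩), b)) := by
        show _ = e0 _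
        simp [e0, sec]
      have g2 : τ (cls 1, ⟨i+1, by omega⟩) = (cls (φ (s i))⁻¹, ⟨i, by omega⟩) := by
        simp only [τ]
        rw [dif_pos (by exact ⟨trivial, Nat.succ_pos i⟩)]
        rfl
      have g3 : bb 1 = 1 := by
        rw [← map_one mk, hbb, map_one]
      have g4 : ∀ b, sec ⟨i, by omega⟩ b (cls (φ (s i))⁻¹)
          = (if b then (1 : Q) else ((mk d)⁻¹ : R)) * (φ (s i))⁻¹ := by
        intro b
        simp only [sec]
        rw [if_neg, if_pos trivial]
        rintro ⟨h1, h2⟩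
        exact hne i h2 hi h1
      rw [g1, hDe]
      show e0 _ = _
      simp only [D0, e0]
      rw [g2, g3, one_mul]
      show (_ * sec ⟨i, by omega⟩ (!b) (cls (φ (s i))⁻¹), _) = _
      rw [g4]
      cases b <;> simp

end Criterion2

section Criterion3

variable {G A C : Type} [Group G] [Group A] [Group C]

theorem rf_criterion (ι : A →* G) (γ : C →* A) (β : C →* C) (d : C) (δ : G)
    (hβd : β d = d) (hββ : ∀ c, β (β c) = d * c * d⁻¹)
    (hδ2 : δ * δ = ι (γ d)) (hδ : ∀ c, δ * ι (γ c) = ι (γ (β c)) * δ)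
    (hgen : Subgroup.closure (Set.range ι ∪ {δ}) = ⊤)
    (huniv : ∀ (H : Type) [Group H] (j : A →* H) (D : H), D * D = j (γ d) →
      (∀ c, D * j (γ c) = j (γ (β c)) * D) → ∃ Ψ : G →* H, (∀ a, Ψ (ι a) = j a) ∧ Ψ δ = D)
    (hsep : ∀ (S : Finset A), (∀ a ∈ S, a ∉ γ.range) → ∀ a₀ : A, ∃ (Q : Type) (_ : Group Q)
      (_ : Finite Q) (φ : A →* Q), (∀ c, φ (γ c) = 1 → φ (γ (β c)) = 1) ∧
      (∀ a ∈ S, φ a ∉ (φ.comp γ).range) ∧ (a₀ ≠ 1 → φ a₀ ≠ 1)) :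
    ResiduallyFinite G := by
  classical
  intro g hg
  obtain ⟨k, s, hs, rfl⟩ := isRed_all hδ2 hδ hgen g
  obtain ⟨Q, _, _, φ, h1, h2, h3⟩ := hsep ((Finset.Ioo 0 k).image s) (by
    intro a ha
    obtain ⟨i, hi, rfl⟩ := Finset.mem_image.mp ha
    rw [Finset.mem_Ioo] at hi
    exact hs i hi.1 hi.2) (s 0)
  by_cases hk : k = 0
  · subst hk
    have hs0 : s 0 ≠ 1 := by
      intro h
      apply hg
      simp [wordOf, h]
    obtain ⟨Ω, _, j, D, hD1, hD2, hj, -⟩ :=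
      exists_perm_rep φ γ β d hβd hββ h1 0 s (fun i h1 h2 => by omega)
    obtain ⟨Ψ, hΨ1, hΨ2⟩ := huniv _ j D hD1 hD2
    refine ⟨Equiv.Perm Ω, inferInstance, inferInstance, Ψ, ?_⟩
    intro h
    rw [wordOf, hΨ1] at h
    exact h3 hs0 (hj _ h)
  · obtain ⟨Ω, _, j, D, hD1, hD2, -, pt, lev, hl, hp, hd⟩ :=
      exists_perm_rep φ γ β d hβd hββ h1 k s (fun i a1 a2 => h2 _ (Finset.mem_image.mpr
        ⟨i, Finset.mem_Ioo.mpr ⟨a1, a2⟩, rfl⟩))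
    obtain ⟨Ψ, hΨ1, hΨ2⟩ := huniv _ j D hD1 hD2
    refine ⟨Equiv.Perm Ω, inferInstance, inferInstance, Ψ, ?_⟩
    have main : ∀ i, i ≤ k → ∀ b, ∃ b', Ψ (wordOf ι δ s i) (pt (s i)⁻¹ i b) = pt 1 0 b' := by
      intro i
      induction i with
      | zero =>
        intro hi b
        exact ⟨b, by rw [wordOf, hΨ1, hp _ _ _ hi]⟩
      | succ i ih =>
        intro hi b
        obtain ⟨b', hb'⟩ := ih (by omega) (!b)
        refine ⟨b', ?_⟩
        rw [wordOf, map_mul, map_mul, hΨ1, hΨ2, Equiv.Perm.mul_apply, Equiv.Perm.mul_apply,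
          hp _ _ _ hi, hd _ _ (by omega), hb']
    intro h
    obtain ⟨b', hb'⟩ := main k le_rfl true
    rw [h, Equiv.Perm.one_apply] at hb'
    have := congrArg lev hb'
    rw [hl _ _ _ le_rfl, hl _ _ _ (by omega)] at this
    exact hk this

end Criterion3

/-! ### Separation from one finite quotient with a retraction -/

section Separation

variable {A C : Type} [Group A] [Group C]

theorem exists_verbal_quotient [Group.FG A] {Q₀ : Type} [Group Q₀] [Finite Q₀] (φ₀ : A →* Q₀)
    (H : Type) [Group H] [Finite H] :
    ∃ (Q : Type) (_ : Group Q) (_ : Finite Q) (φ : A →* Q),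
      ∀ a, φ a = 1 ↔ ∃ h : a ∈ φ₀.ker, ∀ f : φ₀.ker →* H, f ⟨a, h⟩ = 1 := by
  classical
  have hfi : φ₀.ker.FiniteIndex := inferInstance
  have hfg : Group.FG φ₀.ker := inferInstance
  have hfin : Finite (φ₀.ker →* H) := by
    obtain ⟨S, hS⟩ := (Group.fg_def.mp hfg)
    refine Finite.of_injective (fun f : φ₀.ker →* H => fun s : S => f s.1) ?_
    intro f g hfg
    apply MonoidHom.eq_of_eqOn_dense hS
    intro x hx
    exact congrFun hfg ⟨x, hx⟩
  let ev : φ₀.ker →* ((φ₀.ker →* H) → H) :=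
    MonoidHom.pi fun f => f
  have hev : ∀ k, k ∈ ev.ker ↔ ∀ f : φ₀.ker →* H, f k = 1 := by
    intro k
    rw [MonoidHom.mem_ker]
    constructor
    · intro h f
      exact congrFun h f
    · intro h
      funext f
      exact h f
  have : ev.ker.Characteristic := by
    rw [Subgroup.characteristic_iff_le_comap]
    intro θ k hk
    rw [Subgroup.mem_comap, hev]
    intro f
    exact (hev k).mp hk (f.comp θ.toMonoidHom)
  let N : Subgroup A := ev.ker.map φ₀.ker.subtype
  have hN : N.Normal := inferInstance
  have : N.FiniteIndex := by
    constructor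
    show (ev.ker.map φ₀.ker.subtype).index ≠ 0
    rw [Subgroup.index_map_subtype]
    exact mul_ne_zero Subgroup.FiniteIndex.index_ne_zero Subgroup.FiniteIndex.index_ne_zero
  refine ⟨A ⧸ N, inferInstance, inferInstance, QuotientGroup.mk' N, ?_⟩
  intro a
  rw [← MonoidHom.mem_ker, QuotientGroup.ker_mk', Subgroup.mem_map]
  constructor
  · rintro ⟨k, hk, rfl⟩
    exact ⟨k.2, (hev k).mp hk⟩
  · rintro ⟨h, hf⟩
    exact ⟨⟨a, h⟩, (hev _).mpr hf, rfl⟩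

theorem sep_of_retract [Group.FG A]
    (hrf : ∀ a : A, a ≠ 1 → ∃ (Q : Type) (_ : Group Q) (_ : Finite Q) (φ : A →* Q), φ a ≠ 1)
    (γ : C →* A) (β : C →* C) {Q₀ : Type} [Group Q₀] [Finite Q₀] (φ₀ : A →* Q₀)
    (hβ : ∀ c, φ₀ (γ c) = 1 → φ₀ (γ (β c)) = 1)
    (ρ : φ₀.ker →* C) (hρ1 : ∀ k, φ₀ (γ (ρ k)) = 1)
    (hρ2 : ∀ c (h : γ c ∈ φ₀.ker), ρ ⟨γ c, h⟩ = c)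
    (S : Finset A) (hS : ∀ a ∈ S, a ∉ γ.range) (a₀ : A) :
    ∃ (Q : Type) (_ : Group Q) (_ : Finite Q) (φ : A →* Q),
      (∀ c, φ (γ c) = 1 → φ (γ (β c)) = 1) ∧
      (∀ a ∈ S, φ a ∉ (φ.comp γ).range) ∧ (a₀ ≠ 1 → φ a₀ ≠ 1) := by
  classical
  have hrf' : ∀ a : A, ∃ (Q : Type) (_ : Group Q) (_ : Finite Q) (φ : A →* Q), a ≠ 1 → φ a ≠ 1 := by
    intro a
    by_cases h : a = 1
    · exact ⟨Unit, inferInstance, inferInstance, 1, fun h' => absurd h h'⟩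
    · obtain ⟨Q, i1, i2, φ, hφ⟩ := hrf a h
      exact ⟨Q, i1, i2, φ, fun _ => hφ⟩
  choose HH i1 i2 ff hff using hrf'
  have hw : ∀ a : A, ∃ w : A, a ∉ γ.range → ∀ c, φ₀ a = φ₀ (γ c) →
      w ≠ 1 ∧ ∃ (c₀ : C) (h : (γ c₀)⁻¹ * a ∈ φ₀.ker),
        w = ((γ c₀)⁻¹ * a)⁻¹ * γ (ρ ⟨(γ c₀)⁻¹ * a, h⟩) := by
    intro a
    by_cases h : ∃ c₀, φ₀ a = φ₀ (γ c₀)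
    · obtain ⟨c₀, h⟩ := h
      have hk : (γ c₀)⁻¹ * a ∈ φ₀.ker := by
        rw [MonoidHom.mem_ker, map_mul, map_inv, h, inv_mul_cancel]
      refine ⟨_, fun ha c _ => ⟨?_, c₀, hk, rfl⟩⟩
      intro h1
      apply ha
      rw [inv_mul_eq_one] at h1
      refine ⟨c₀ * ρ ⟨(γ c₀)⁻¹ * a, hk⟩, ?_⟩
      rw [map_mul, ← h1]
      group
    · exact ⟨1, fun _ c hc => absurd ⟨c, hc⟩ h⟩
  choose w hw using hw
  let T : Finset A := insert a₀ (S.image w)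
  obtain ⟨Q, j1, j2, φ, hφ⟩ := exists_verbal_quotient φ₀ (∀ t : T, HH t.1)
  have key : ∀ n, φ n = 1 → ∃ h : n ∈ φ₀.ker, ∀ t ∈ T, ∀ f : φ₀.ker →* HH t, f ⟨n, h⟩ = 1 := by
    intro n hn
    obtain ⟨h, hf⟩ := (hφ n).mp hn
    refine ⟨h, fun t ht f => ?_⟩
    have := hf ((MonoidHom.mulSingle (fun t : T => HH t.1) ⟨t, ht⟩).comp f)
    have h2 := congrFun this ⟨t, ht⟩
    simpa using h2
  let ret : φ₀.ker →* φ₀.ker :=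
    { toFun := fun k => ⟨γ (ρ k), hρ1 k⟩
      map_one' := by ext; simp
      map_mul' := by intro a b; ext; simp }
  refine ⟨Q, j1, j2, φ, ?_, ?_, ?_⟩
  · intro c hc
    obtain ⟨h, hf⟩ := (hφ _).mp hc
    rw [hφ]
    refine ⟨hβ c h, fun f => ?_⟩
    let f' : φ₀.ker →* φ₀.ker :=
      { toFun := fun k => ⟨γ (β (ρ k)), hβ _ (hρ1 k)⟩
        map_one' := by ext; simp
        map_mul' := by intro a b; ext; simp }
    have := hf (f.comp f')
    have e : f' ⟨γ c, h⟩ = ⟨γ (β c), hβ c h⟩ := by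
      apply Subtype.ext
      show γ (β (ρ ⟨γ c, h⟩)) = _
      rw [hρ2]
    rw [MonoidHom.comp_apply, e] at this
    exact this
  · rintro a ha ⟨c, hc⟩
    have hn : φ ((γ c)⁻¹ * a) = 1 := by
      rw [map_mul, map_inv, ← hc]
      simp
    obtain ⟨hn0, hnt⟩ := key _ hn
    have h0 : φ₀ a = φ₀ (γ c) := by
      rw [MonoidHom.mem_ker, map_mul, map_inv, inv_mul_eq_one] at hn0
      exact hn0.symm
    obtain ⟨hw1, c₀, hk, hwe⟩ := hw a (hS a ha) c h0
    have hwT : w a ∈ T := Finset.mem_insert_of_mem (Finset.mem_image_of_mem _ ha)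
    apply hff (w a) hw1
    let f : φ₀.ker →* HH (w a) := (ff (w a)).comp φ₀.ker.subtype
    have q1 := hnt (w a) hwT f
    have q2 := hnt (w a) hwT (f.comp ret)
    have hc1 : γ (c₀⁻¹ * c) ∈ φ₀.ker := by
      have : γ (c₀⁻¹ * c) = ((γ c₀)⁻¹ * a) * ((γ c)⁻¹ * a)⁻¹ := by
        rw [map_mul, map_inv]; group
      rw [this]
      exact mul_mem hk (inv_mem hn0)
    have e : (⟨(γ c₀)⁻¹ * a, hk⟩ : φ₀.ker) = ⟨γ (c₀⁻¹ * c), hc1⟩ * ⟨(γ c)⁻¹ * a, hn0⟩ := by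
      apply Subtype.ext
      show (γ c₀)⁻¹ * a = γ (c₀⁻¹ * c) * ((γ c)⁻¹ * a)
      rw [map_mul, map_inv]; group
    have r1 : f ⟨(γ c₀)⁻¹ * a, hk⟩ = f ⟨γ (c₀⁻¹ * c), hc1⟩ := by
      rw [e, map_mul, q1, mul_one]
    have r2 : f (ret ⟨(γ c₀)⁻¹ * a, hk⟩) = f ⟨γ (c₀⁻¹ * c), hc1⟩ := by
      have : ret ⟨γ (c₀⁻¹ * c), hc1⟩ = ⟨γ (c₀⁻¹ * c), hc1⟩ := by
        apply Subtype.ext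
        show γ (ρ _) = _
        rw [hρ2]
      rw [e, map_mul, map_mul, this]
      rw [MonoidHom.comp_apply] at q2
      rw [q2, mul_one]
    have r3 : ff (w a) (w a) = (f ⟨(γ c₀)⁻¹ * a, hk⟩)⁻¹ * f (ret ⟨(γ c₀)⁻¹ * a, hk⟩) := by
      have : w a = (((⟨(γ c₀)⁻¹ * a, hk⟩ : φ₀.ker)⁻¹ * ret ⟨(γ c₀)⁻¹ * a, hk⟩ : φ₀.ker) : A) := hwe
      rw [← map_inv, ← map_mul]
      show _ = ff (w a) _
      exact congrArg (ff (w a)) this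
    rw [r3, r1, r2, inv_mul_cancel]
  · intro h h1
    obtain ⟨h2, h3⟩ := key _ h1
    exact hff a₀ h (h3 a₀ (Finset.mem_insert_self _ _) ((ff a₀).comp φ₀.ker.subtype))

end Separation

/-! ### Construction of the retraction -/

section Retraction

variable {C Q : Type} [Group C] [Group Q]

open Classical in
/-- The cocycle used to define the twisted action. -/
noncomputable def cocyc (θ : C →* Q) (σ : Q → C) (S : Q) (L : ℕ) (g : ℕ → C) (κ : Q) : C :=
  if h : ∃ i, i < L ∧ (S ^ i)⁻¹ * κ ∈ θ.range then
    (σ (θ (g (h.choose + 1) * (g h.choose)⁻¹) * (θ (g h.choose) * ((S ^ h.choose)⁻¹ * κ))))⁻¹ *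
      (g (h.choose + 1) * (g h.choose)⁻¹) * σ (θ (g h.choose) * ((S ^ h.choose)⁻¹ * κ))
  else 1

theorem cocyc_mem (θ : C →* Q) (σ : Q → C) (hσ : ∀ q ∈ θ.range, θ (σ q) = q) (S : Q) (L : ℕ)
    (g : ℕ → C) (κ : Q) : cocyc θ σ S L g κ ∈ θ.ker := by
  unfold cocyc
  split_ifs with h
  · have hc := h.choose_spec.2
    have h1 : θ (g h.choose) * ((S ^ h.choose)⁻¹ * κ) ∈ θ.range := mul_mem ⟨_, rfl⟩ hc
    have h2 : θ (g (h.choose + 1) * (g h.choose)⁻¹) *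
        (θ (g h.choose) * ((S ^ h.choose)⁻¹ * κ)) ∈ θ.range := mul_mem ⟨_, rfl⟩ h1
    rw [MonoidHom.mem_ker, map_mul, map_mul, map_inv, hσ _ h1, hσ _ h2]
    group
  · exact one_mem _

theorem cocyc_eq (θ : C →* Q) (σ : Q → C) (S : Q) (L : ℕ)
    (g : ℕ → C) (hS : ∀ i, 0 < i → i < L → S ^ i ∉ θ.range) (i : ℕ) (hi : i < L) (c : C) :
    cocyc θ σ S L g (S ^ i * θ c) =
      (σ (θ (g (i + 1) * c)))⁻¹ * (g (i + 1) * (g i)⁻¹) * σ (θ (g i * c)) := by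
  have h : ∃ j, j < L ∧ (S ^ j)⁻¹ * (S ^ i * θ c) ∈ θ.range := ⟨i, hi, c, by group⟩
  have hj : h.choose = i := by
    have h1 := h.choose_spec.1
    have h2 := h.choose_spec.2
    set j := h.choose
    have h3 : (S ^ j)⁻¹ * S ^ i ∈ θ.range := by
      have := mul_mem h2 (inv_mem (⟨c, rfl⟩ : θ c ∈ θ.range))
      convert this using 1
      group
    rcases lt_trichotomy j i with hlt | heq | hgt
    · exfalso
      apply hS (i - j) (by omega) (by omega)
      have : S ^ i = S ^ j * S ^ (i - j) := by rw [← pow_add]; congr 1; omega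
      rw [this, inv_mul_cancel_left] at h3
      exact h3
    · exact heq
    · exfalso
      apply hS (j - i) (by omega) (by omega)
      have : S ^ j = S ^ i * S ^ (j - i) := by rw [← pow_add]; congr 1; omega
      have h4 := inv_mem h3
      rw [this] at h4
      convert h4 using 1
      group
  unfold cocyc
  rw [dif_pos h, hj]
  have e1 : θ (g i) * ((S ^ i)⁻¹ * (S ^ i * θ c)) = θ (g i * c) := by
    rw [inv_mul_cancel_left, map_mul]
  have e2 : θ (g (i + 1) * (g i)⁻¹) * θ (g i * c) = θ (g (i + 1) * c) := by
    rw [← map_mul]; congr 1; group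
  rw [e1, e2]

/-- Left translation twisted by a cocycle. -/
def twistPerm {K : Type} [Group K] (S : Q) (f : Q → K) : Equiv.Perm (Q × K) where
  toFun p := (S * p.1, f p.1 * p.2)
  invFun p := (S⁻¹ * p.1, (f (S⁻¹ * p.1))⁻¹ * p.2)
  left_inv p := by ext <;> simp
  right_inv p := by ext <;> simp

theorem exists_retraction (γ : C →* FreeGroup (Fin 3)) (φ : FreeGroup (Fin 3) →* Q)
    (L : Fin 3 → ℕ) (g : Fin 3 → ℕ → C) (hg0 : ∀ s, g s 0 = 1) (hgx : ∀ i, i < L 0 → g 0 i = 1)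
    (hnot : ∀ s i, 0 < i → i < L s → φ (FreeGroup.of s) ^ i ∉ (φ.comp γ).range)
    (hgen : Subgroup.closure {u : C | ∃ s j i, j ≤ L s ∧ i < L 0 ∧ g s j = u ∧
      γ u = (FreeGroup.of 0 ^ i)⁻¹ * FreeGroup.of s ^ j} = ⊤) :
    ∃ ρ : φ.ker →* C, (∀ k, φ (γ (ρ k)) = 1) ∧ ∀ c (h : γ c ∈ φ.ker), ρ ⟨γ c, h⟩ = c := by
  classical
  set θ : C →* Q := φ.comp γ with hθ
  have hθa : ∀ c, θ c = φ (γ c) := fun c => rfl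
  obtain ⟨σ, hσ, hσ1⟩ : ∃ σ : Q → C, (∀ q ∈ θ.range, θ (σ q) = q) ∧ σ 1 = 1 := by
    refine ⟨fun q => if q = 1 then 1 else if h : ∃ c, θ c = q then h.choose else 1, ?_, by simp⟩
    rintro q ⟨c, hc⟩
    by_cases h1 : q = 1
    · simp [h1]
    · have h : ∃ c, θ c = q := ⟨c, hc⟩
      simp only [h1, if_false, dif_pos h]
      exact h.choose_spec
  let K := θ.ker
  let f : Fin 3 → Q → K := fun s κ =>
    ⟨cocyc θ σ (φ (FreeGroup.of s)) (L s) (g s) κ, cocyc_mem θ σ hσ _ _ _ _⟩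
  let T : FreeGroup (Fin 3) →* Equiv.Perm (Q × K) :=
    FreeGroup.lift fun s => twistPerm (φ (FreeGroup.of s)) (f s)
  have hT : ∀ s p, T (FreeGroup.of s) p = (φ (FreeGroup.of s) * p.1, f s p.1 * p.2) := by
    intro s p
    simp only [T, FreeGroup.lift_apply_of]
    rfl
  have hfst : ∀ w p, (T w p).1 = φ w * p.1 := by
    intro w
    induction w using FreeGroup.induction_on with
    | C1 => simp
    | of s => intro p; rw [hT]
    | inv_of s ih =>
      intro p
      rw [map_inv, map_inv, eq_inv_mul_iff_mul_eq, ← ih]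
      simp
    | mul a b ha hb => intro p; rw [map_mul, Equiv.Perm.mul_apply, ha, hb, map_mul, mul_assoc]
  have hsnd : ∀ w p k, T w (p.1, p.2 * k) = ((T w p).1, (T w p).2 * k) := by
    intro w
    induction w using FreeGroup.induction_on with
    | C1 => simp
    | of s => intro p k; rw [hT, hT]; simp [mul_assoc]
    | inv_of s ih =>
      intro p k
      rw [map_inv, Equiv.Perm.inv_eq_iff_eq, ih]
      simp
    | mul a b ha hb => intro p k; rw [map_mul, Equiv.Perm.mul_apply, hb, ha]; rfl
  let τ : C → K := fun c => ⟨(σ (θ c))⁻¹ * c, by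
    rw [MonoidHom.mem_ker, map_mul, map_inv, hσ _ ⟨c, rfl⟩]; group⟩
  have hpow : ∀ s i, i ≤ L s → ∀ c, T (FreeGroup.of s ^ i) (θ c, τ c) =
      (φ (FreeGroup.of s) ^ i * θ c, τ (g s i * c)) := by
    intro s i
    induction i with
    | zero => intro _ c; simp [hg0]
    | succ i ih =>
      intro hi c
      rw [pow_succ', map_mul, Equiv.Perm.mul_apply, ih (by omega), hT]
      ext1
      · simp only; rw [pow_succ', mul_assoc]
      · apply Subtype.ext
        show cocyc θ σ (φ (FreeGroup.of s)) (L s) (g s) (φ (FreeGroup.of s) ^ i * θ c) *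
          ((σ (θ (g s i * c)))⁻¹ * (g s i * c)) = (σ (θ (g s (i+1) * c)))⁻¹ * (g s (i+1) * c)
        rw [cocyc_eq θ σ _ _ _ (hnot s) i (by omega)]
        group
  have hJ : ∀ c c', T (γ c) (θ c', τ c') = (θ (c * c'), τ (c * c')) := by
    let H : Subgroup C :=
      { carrier := {c | ∀ c', T (γ c) (θ c', τ c') = (θ (c * c'), τ (c * c'))}
        one_mem' := by intro c'; simp
        mul_mem' := by
          intro a b ha hb c'
          rw [map_mul, map_mul, Equiv.Perm.mul_apply, hb, ha, mul_assoc]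
        inv_mem' := by
          intro a ha c'
          rw [map_inv, map_inv, Equiv.Perm.inv_eq_iff_eq, ha, mul_inv_cancel_left] }
    have hH : H = ⊤ := by
      rw [eq_top_iff, ← hgen, Subgroup.closure_le]
      rintro u ⟨s, j, i, hj, hi, hu, hγ⟩ c'
      have hθu : θ u = (φ (FreeGroup.of 0) ^ i)⁻¹ * φ (FreeGroup.of s) ^ j := by
        rw [hθa, hγ]; simp
      rw [hγ, map_mul, map_inv, Equiv.Perm.mul_apply, Equiv.Perm.inv_eq_iff_eq, hpow s j hj,
        hpow 0 i hi.le, hgx i hi, one_mul, hu, map_mul θ, hθu]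
      ext1
      · simp only; group
      · rfl
    intro c
    have : c ∈ H := hH ▸ Subgroup.mem_top c
    exact this
  have hfix : ∀ k : φ.ker, (T k.1 (1, 1)).1 = 1 := by
    intro k
    rw [hfst, mul_one]
    exact k.2
  refine ⟨{ toFun := fun k => ((T k.1 (1, 1)).2 : C)
            map_one' := by simp
            map_mul' := ?_ }, ?_, ?_⟩
  · intro a b
    have hb : T b.1 (1, 1) = (1, (T b.1 (1, 1)).2) := Prod.ext (hfix b) rfl
    have h1 := hsnd a.1 (1, 1) (T b.1 (1, 1)).2
    simp only [one_mul] at h1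
    rw [Subgroup.coe_mul, map_mul, Equiv.Perm.mul_apply, hb, h1]
    rfl
  · intro k
    exact (T k.1 (1, 1)).2.2
  · intro c h
    have h1 := hJ c 1
    have h2 : (θ 1, τ 1) = ((1, 1) : Q × K) := by
      ext1
      · simp
      · apply Subtype.ext
        show (σ (θ 1))⁻¹ * 1 = 1
        rw [map_one, hσ1]; simp
    rw [h2, mul_one] at h1
    show ((T (γ c) (1, 1)).2 : C) = c
    rw [h1]
    show (σ (θ c))⁻¹ * c = c
    have : θ c = 1 := h
    rw [this, hσ1]; simp

end Retraction

/-! ### A finite permutation representation -/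

section FiniteRep

theorem path_root {F : Type} [Field F] (ζ : F) (h0 : ζ ≠ 0) (e f : F)
    (he : e = 1 + (ζ + ζ⁻¹) + (ζ ^ 2 + ζ⁻¹ ^ 2))
    (hf : f = 2 + (ζ + ζ⁻¹) * (ζ ^ 2 + ζ⁻¹ ^ 2) + (ζ + ζ⁻¹) + (ζ ^ 2 + ζ⁻¹ ^ 2))
    (j : ℕ) (hj : j < 5) (z : F) (hz : z = ζ ^ j * ζ⁻¹ ^ 2) :
    z ^ 5 = e * z ^ 4 - f * z ^ 3 + f * z ^ 2 - e * z + 1 := by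
  have key : z ^ 5 - (e * z ^ 4 - f * z ^ 3 + f * z ^ 2 - e * z + 1) =
      (z - 1) * (z ^ 2 - (ζ + ζ⁻¹) * z + 1) * (z ^ 2 - (ζ ^ 2 + ζ⁻¹ ^ 2) * z + 1) := by
    rw [he, hf]; ring
  rw [← sub_eq_zero, key]
  interval_cases j
  · have : z ^ 2 - (ζ ^ 2 + ζ⁻¹ ^ 2) * z + 1 = 0 := by
      rw [hz]; field_simp; ring
    rw [this, mul_zero]
  · have : z ^ 2 - (ζ + ζ⁻¹) * z + 1 = 0 := by
      rw [hz]; field_simp; ring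
    rw [this]; ring
  · have : z - 1 = 0 := by
      rw [hz]; field_simp; ring
    rw [this]; ring
  · have : z ^ 2 - (ζ + ζ⁻¹) * z + 1 = 0 := by
      rw [hz]; field_simp; ring
    rw [this]; ring
  · have : z ^ 2 - (ζ ^ 2 + ζ⁻¹ ^ 2) * z + 1 = 0 := by
      rw [hz]; field_simp; ring
    rw [this, mul_zero]

theorem path_lemma {F V : Type} [Field F] (m : ℕ) (hm : 2 ≤ m) (ζ : F)
    (hζ : IsPrimitiveRoot ζ (2 * m + 1)) (e f e1 f1 e2 f2 : F)
    (he : e = 1 + (ζ + ζ⁻¹) + (ζ ^ 2 + ζ⁻¹ ^ 2))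
    (hf : f = 2 + (ζ + ζ⁻¹) * (ζ ^ 2 + ζ⁻¹ ^ 2) + (ζ + ζ⁻¹) + (ζ ^ 2 + ζ⁻¹ ^ 2))
    (A B : Equiv.Perm V) (t s u0 u1 u2 μ : V → F)
    (hext : ∀ v w, t v = t w → s v = s w → u0 v = u0 w → u1 v = u1 w → u2 v = u2 w →
      μ v = μ w → v = w)
    (hA : ∀ v, t (A v) = t v ∧ s (A v) = u2 v - e * t v - e1 * μ v ∧
      u0 (A v) = u1 v + f * t v - f1 * μ v ∧ u1 (A v) = u0 v - f * t v + f1 * μ v ∧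
      u2 (A v) = s v + e * t v + e1 * μ v ∧ μ (A v) = μ v)
    (hB : ∀ v, u2 (B v) = u2 v ∧ u1 (B v) = t v - e * u2 v - e2 * μ v ∧
      u0 (B v) = s v + f * u2 v - f2 * μ v ∧ s (B v) = u0 v - f * u2 v + f2 * μ v ∧
      t (B v) = u1 v + e * u2 v + e2 * μ v ∧ μ (B v) = μ v)
    (o : V) (hot : t o = 0) (hos : s o = 0) (ho0 : u0 o = 1) (ho1 : u1 o = 0) (ho2 : u2 o = 0)
    (hoμ : μ o = 0) :
    (B * A) ^ (2 * m + 1) = 1 ∧ ((B * A) ^ m) o = A o ∧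
      ∀ i, ((B * A) ^ i) o = o → (2 * m + 1) ∣ i := by
  have h0 : ζ ≠ 0 := hζ.ne_zero (by omega)
  let lam : F → V → F := fun z v => t v + z * s v + z ^ 2 * u0 v + z ^ 3 * u1 v + z ^ 4 * u2 v
  let nd : ℕ → F := fun j => ζ ^ j * ζ⁻¹ ^ 2
  have hnd0 : ∀ j, nd j ≠ 0 := fun j =>
    mul_ne_zero (pow_ne_zero _ h0) (pow_ne_zero _ (inv_ne_zero h0))
  have hndM : ∀ j, nd j ^ (2 * m + 1) = 1 := by
    intro j
    simp only [nd]
    rw [mul_pow, ← pow_mul, ← pow_mul, mul_comm j, mul_comm 2 (2 * m + 1), pow_mul, pow_mul,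
      inv_pow, hζ.pow_eq_one]
    simp
  have hndinj : ∀ i j, i < 5 → j < 5 → nd i = nd j → i = j := by
    intro i j hi hj h
    exact hζ.pow_inj (by omega) (by omega)
      (mul_right_cancel₀ (pow_ne_zero _ (inv_ne_zero h0)) h)
  -- one step
  have step : ∀ j, j < 5 → ∃ k : F, (nd j = 1 → k = 0) ∧
      ∀ v, lam (nd j) (B (A v)) = (nd j)⁻¹ ^ 2 * lam (nd j) v + k * μ v := by
    intro j hj
    have hr := path_root ζ h0 e f he hf j hj (nd j) rfl
    have hz := hnd0 j
    generalize nd j = z at hr hz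
    have hA1 : ∀ v, lam z⁻¹ (A v) = z⁻¹ ^ 5 * lam z v +
        (-e1 * z⁻¹ - f1 * z⁻¹ ^ 2 + f1 * z⁻¹ ^ 3 + e1 * z⁻¹ ^ 4) * μ v := by
      intro v
      obtain ⟨a1, a2, a3, a4, a5, a6⟩ := hA v
      simp only [lam]
      rw [a1, a2, a3, a4, a5]
      field_simp
      linear_combination (t v) * hr
    have hB1 : ∀ v, lam z (B v) = z ^ 3 * lam z⁻¹ v +
        (e2 + f2 * z - f2 * z ^ 2 - e2 * z ^ 3) * μ v := by
      intro v
      obtain ⟨a1, a2, a3, a4, a5, a6⟩ := hB v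
      simp only [lam]
      rw [a1, a2, a3, a4, a5]
      field_simp
      linear_combination (u2 v) * hr
    refine ⟨z ^ 3 * (-e1 * z⁻¹ - f1 * z⁻¹ ^ 2 + f1 * z⁻¹ ^ 3 + e1 * z⁻¹ ^ 4) +
      (e2 + f2 * z - f2 * z ^ 2 - e2 * z ^ 3), ?_, ?_⟩
    · intro h; rw [h]; simp
    · intro v
      rw [hB1, hA1, (hA v).2.2.2.2.2]
      field_simp
      ring
  have hμ : ∀ v, μ (B (A v)) = μ v := fun v => by
    rw [(hB (A v)).2.2.2.2.2, (hA v).2.2.2.2.2]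
  have hμi : ∀ i v, μ (((B * A) ^ i) v) = μ v := by
    intro i
    induction i with
    | zero => simp
    | succ i ih => intro v; rw [pow_succ', Equiv.Perm.mul_apply, Equiv.Perm.mul_apply, hμ, ih]
  have iter : ∀ j, j < 5 → ∃ k : F, (nd j = 1 → k = 0) ∧ ∀ i v,
      lam (nd j) (((B * A) ^ i) v) = ((nd j)⁻¹ ^ 2) ^ i * lam (nd j) v +
        k * (∑ l ∈ Finset.range i, ((nd j)⁻¹ ^ 2) ^ l) * μ v := by
    intro j hj
    obtain ⟨k, hk1, hk⟩ := step j hj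
    refine ⟨k, hk1, fun i => ?_⟩
    induction i with
    | zero => simp
    | succ i ih =>
      intro v
      rw [pow_succ', Equiv.Perm.mul_apply, Equiv.Perm.mul_apply, hk, hμi, ih, geom_sum_succ]
      ring
  have sep : ∀ v w, (∀ j, j < 5 → lam (nd j) v = lam (nd j) w) → μ v = μ w → v = w := by
    intro v w h hm'
    have := Matrix.eq_zero_of_forall_index_sum_pow_mul_eq_zero (R := F) (n := 5)
      (f := fun j : Fin 5 => nd j)
      (v := ![t v - t w, s v - s w, u0 v - u0 w, u1 v - u1 w, u2 v - u2 w])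
      (fun i j hij => Fin.ext (hndinj i j i.2 j.2 hij))
      (fun j => by
        have := h j j.2
        simp only [lam] at this
        simp [Fin.sum_univ_succ]
        linear_combination this)
    have g0 := congrFun this 0
    have g1 := congrFun this 1
    have g2 := congrFun this 2
    have g3 := congrFun this 3
    have g4 := congrFun this 4
    simp at g0 g1 g2 g3 g4
    exact hext v w (sub_eq_zero.mp g0) (sub_eq_zero.mp g1) (sub_eq_zero.mp g2)
      (sub_eq_zero.mp g3) (sub_eq_zero.mp g4) hm'
  have hlo : ∀ z, lam z o = z ^ 2 := by
    intro z
    simp only [lam]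
    rw [hot, hos, ho0, ho1, ho2]; ring
  have hlAo : ∀ z, lam z (A o) = z ^ 3 := by
    intro z
    obtain ⟨a1, a2, a3, a4, a5, a6⟩ := hA o
    simp only [lam]
    rw [a1, a2, a3, a4, a5, hot, hos, ho0, ho1, ho2, hoμ]; ring
  refine ⟨?_, ?_, ?_⟩
  · ext v
    apply sep
    · intro j hj
      obtain ⟨k, hk1, hk⟩ := iter j hj
      rw [hk]
      have hone : ((nd j)⁻¹ ^ 2) ^ (2 * m + 1) = 1 := by
        rw [← pow_mul, mul_comm, pow_mul, inv_pow, hndM]; simp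
      rw [hone]
      have : k * (∑ l ∈ Finset.range (2 * m + 1), ((nd j)⁻¹ ^ 2) ^ l) = 0 := by
        by_cases h1 : nd j = 1
        · rw [hk1 h1, zero_mul]
        · have h2 : (nd j)⁻¹ ^ 2 ≠ 1 := by
            intro h2
            rw [inv_pow, inv_eq_one] at h2
            apply h1
            have := hndM j
            rwa [pow_succ, pow_mul, h2, one_pow, one_mul] at this
          have h3 := geom_sum_mul ((nd j)⁻¹ ^ 2) (2 * m + 1)
          rw [hone, sub_self] at h3
          rcases mul_eq_zero.mp h3 with h4 | h4
          · rw [h4, mul_zero]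
          · exact absurd (sub_eq_zero.mp h4) h2
      rw [this]; simp
    · rw [hμi]; rfl
  · apply sep
    · intro j hj
      obtain ⟨k, hk1, hk⟩ := iter j hj
      rw [hk, hlo, hlAo, hoμ, mul_zero, add_zero]
      have h1 := hndM j
      have h2 : ((nd j)⁻¹ ^ 2) ^ m = nd j := by
        rw [← pow_mul, inv_pow]
        apply inv_eq_of_mul_eq_one_right
        rw [← pow_succ, h1]
      rw [h2]; ring
    · rw [hμi, (hA o).2.2.2.2.2]
  · intro i hi
    obtain ⟨k, hk1, hk⟩ := iter 3 (by norm_num)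
    have h1 := hk i o
    rw [hi, hlo, hoμ, mul_zero, add_zero] at h1
    have h2 : nd 3 = ζ := by simp only [nd]; field_simp
    rw [h2] at h1
    have h3 : (ζ⁻¹ ^ 2) ^ i = 1 := by
      have : ζ ^ 2 ≠ 0 := pow_ne_zero _ h0
      exact mul_right_cancel₀ this (by rw [← h1, one_mul])
    rw [← pow_mul, inv_pow, inv_eq_one] at h3
    have h4 := (hζ.pow_eq_one_iff_dvd _).mp h3
    exact (Nat.Coprime.dvd_mul_left (by simp)).mp h4

theorem exists_prim_root (ℓ k : ℕ) [Fact ℓ.Prime] (h : ℓ ≡ 1 [MOD k]) :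
    ∃ ζ : ZMod ℓ, IsPrimitiveRoot ζ k := by
  have hp : ℓ.Prime := Fact.out
  have hd : k ∣ ℓ - 1 := (Nat.modEq_iff_dvd' hp.one_lt.le).mp h.symm
  obtain ⟨u, hu⟩ := IsCyclic.exists_generator (α := (ZMod ℓ)ˣ)
  have ho : orderOf u = ℓ - 1 := by
    rw [orderOf_eq_card_of_forall_mem_zpowers hu, Nat.card_eq_fintype_card, ZMod.card_units]
  have hprim : IsPrimitiveRoot (u : ZMod ℓ) (ℓ - 1) := by
    rw [IsPrimitiveRoot.coe_units_iff, ← ho]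
    exact IsPrimitiveRoot.orderOf u
  obtain ⟨q, hq⟩ := hd
  have hpos : 0 < ℓ - 1 := Nat.sub_pos_of_lt hp.one_lt
  exact ⟨_, hprim.pow hpos (by rw [hq, mul_comm])⟩

/-- The six coordinates. -/
@[ext] structure Six (F : Type) where
  v0 : F
  p : F
  q : F
  w1 : F
  w2 : F
  w3 : F

instance {F : Type} [Finite F] : Finite (Six F) :=
  Finite.of_injective (fun v : Six F => (v.v0, v.p, v.q, v.w1, v.w2, v.w3)) (by
    intro v w h
    simp only [Prod.mk.injEq] at h
    obtain ⟨h1, h2, h3, h4, h5, h6⟩ := h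
    exact Six.ext h1 h2 h3 h4 h5 h6)

theorem exists_finite_rep (m n p : ℕ) (hm : 2 ≤ m) (hn : 2 ≤ n) (hp : 2 ≤ p) :
    ∃ (V : Type) (_ : Finite V) (a b c : Equiv.Perm V) (v0 vp vq : V),
      (a * a = 1 ∧ b * b = 1 ∧ c * c = 1) ∧
      ((b * a) ^ (2 * m + 1) = 1 ∧ (c * b) ^ (2 * n + 1) = 1 ∧ (a * c) ^ (2 * p + 1) = 1) ∧
      (b v0 = vq ∧ c vq = vp ∧ a vp = v0) ∧
      (((b * a) ^ m) v0 = vp ∧ ((c * b) ^ n) vq = v0 ∧ ((a * c) ^ p) vp = vq) ∧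
      ((∀ i, ((b * a) ^ i) v0 = v0 → (2 * m + 1) ∣ i) ∧
       (∀ i, ((c * b) ^ i) vq = vq → (2 * n + 1) ∣ i) ∧
       (∀ i, ((a * c) ^ i) vp = vp → (2 * p + 1) ∣ i)) := by
  obtain ⟨ℓ, hℓ, -, hmod⟩ := Nat.exists_prime_gt_modEq_one
    (k := (2 * m + 1) * ((2 * n + 1) * (2 * p + 1))) 0 (by positivity)
  have : Fact ℓ.Prime := ⟨hℓ⟩
  obtain ⟨ζ1, hζ1⟩ := exists_prim_root ℓ (2 * m + 1) (hmod.of_mul_right _)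
  obtain ⟨ζ2, hζ2⟩ := exists_prim_root ℓ (2 * n + 1) ((hmod.of_mul_left _).of_mul_right _)
  obtain ⟨ζ3, hζ3⟩ := exists_prim_root ℓ (2 * p + 1) ((hmod.of_mul_left _).of_mul_left _)
  obtain ⟨e1, he1⟩ : ∃ e, e = 1 + (ζ1 + ζ1⁻¹) + (ζ1 ^ 2 + ζ1⁻¹ ^ 2) := ⟨_, rfl⟩
  obtain ⟨e2, he2⟩ : ∃ e, e = 1 + (ζ2 + ζ2⁻¹) + (ζ2 ^ 2 + ζ2⁻¹ ^ 2) := ⟨_, rfl⟩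
  obtain ⟨e3, he3⟩ : ∃ e, e = 1 + (ζ3 + ζ3⁻¹) + (ζ3 ^ 2 + ζ3⁻¹ ^ 2) := ⟨_, rfl⟩
  obtain ⟨f1, hf1⟩ : ∃ f, f = 2 + (ζ1 + ζ1⁻¹) * (ζ1 ^ 2 + ζ1⁻¹ ^ 2) + (ζ1 + ζ1⁻¹) +
    (ζ1 ^ 2 + ζ1⁻¹ ^ 2) := ⟨_, rfl⟩
  obtain ⟨f2, hf2⟩ : ∃ f, f = 2 + (ζ2 + ζ2⁻¹) * (ζ2 ^ 2 + ζ2⁻¹ ^ 2) + (ζ2 + ζ2⁻¹) +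
    (ζ2 ^ 2 + ζ2⁻¹ ^ 2) := ⟨_, rfl⟩
  obtain ⟨f3, hf3⟩ : ∃ f, f = 2 + (ζ3 + ζ3⁻¹) * (ζ3 ^ 2 + ζ3⁻¹ ^ 2) + (ζ3 + ζ3⁻¹) +
    (ζ3 ^ 2 + ζ3⁻¹ ^ 2) := ⟨_, rfl⟩
  let af : Six (ZMod ℓ) → Six (ZMod ℓ) := fun v =>
    ⟨v.p + f1 * v.w1 - f3 * v.w3, v.v0 - f1 * v.w1 + f3 * v.w3, v.w2 - e1 * v.w1 - e3 * v.w3,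
      v.w1, v.q + e1 * v.w1 + e3 * v.w3, v.w3⟩
  let bf : Six (ZMod ℓ) → Six (ZMod ℓ) := fun v =>
    ⟨v.q + f1 * v.w2 - f2 * v.w3, v.w1 - e1 * v.w2 - e2 * v.w3, v.v0 - f1 * v.w2 + f2 * v.w3,
      v.p + e1 * v.w2 + e2 * v.w3, v.w2, v.w3⟩
  let cf : Six (ZMod ℓ) → Six (ZMod ℓ) := fun v =>
    ⟨v.w3 - e2 * v.w1 - e3 * v.w2, v.q - f2 * v.w1 + f3 * v.w2, v.p + f2 * v.w1 - f3 * v.w2,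
      v.w1, v.w2, v.v0 + e2 * v.w1 + e3 * v.w2⟩
  have ha : Function.Involutive af := by intro v; ext <;> simp only [af] <;> ring
  have hb : Function.Involutive bf := by intro v; ext <;> simp only [bf] <;> ring
  have hc : Function.Involutive cf := by intro v; ext <;> simp only [cf] <;> ring
  let a := ha.toPerm
  let b := hb.toPerm
  let c := hc.toPerm
  have ea : ∀ v, a v = af v := fun v => rfl
  have eb : ∀ v, b v = bf v := fun v => rfl
  have ec : ∀ v, c v = cf v := fun v => rfl
  obtain ⟨x1, x2, x3⟩ := path_lemma m hm ζ1 hζ1 e1 f1 e3 f3 e2 f2 he1 hf1 a b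
    Six.w1 Six.q Six.v0 Six.p Six.w2 Six.w3
    (fun v w h1 h2 h3 h4 h5 h6 => Six.ext h3 h4 h2 h1 h5 h6)
    (fun v => by refine ⟨?_, ?_, ?_, ?_, ?_, ?_⟩ <;> simp only [ea, af])
    (fun v => by refine ⟨?_, ?_, ?_, ?_, ?_, ?_⟩ <;> simp only [eb, bf])
    ⟨1, 0, 0, 0, 0, 0⟩ rfl rfl rfl rfl rfl rfl
  obtain ⟨y1, y2, y3⟩ := path_lemma n hn ζ2 hζ2 e2 f2 e1 f1 e3 f3 he2 hf2 b c
    Six.w3 Six.p Six.q Six.v0 Six.w1 Six.w2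
    (fun v w h1 h2 h3 h4 h5 h6 => Six.ext h4 h2 h3 h5 h6 h1)
    (fun v => by refine ⟨?_, ?_, ?_, ?_, ?_, ?_⟩ <;> simp only [eb, bf] <;> ring)
    (fun v => by refine ⟨?_, ?_, ?_, ?_, ?_, ?_⟩ <;> simp only [ec, cf] <;> ring_nf)
    ⟨0, 0, 1, 0, 0, 0⟩ rfl rfl rfl rfl rfl rfl
  obtain ⟨z1, z2, z3⟩ := path_lemma p hp ζ3 hζ3 e3 f3 e2 f2 e1 f1 he3 hf3 c a
    Six.w2 Six.v0 Six.p Six.q Six.w3 Six.w1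
    (fun v w h1 h2 h3 h4 h5 h6 => Six.ext h2 h3 h4 h6 h1 h5)
    (fun v => by refine ⟨?_, ?_, ?_, ?_, ?_, ?_⟩ <;> simp only [ec, cf] <;> ring_nf)
    (fun v => by refine ⟨?_, ?_, ?_, ?_, ?_, ?_⟩ <;> simp only [ea, af] <;> ring)
    ⟨0, 1, 0, 0, 0, 0⟩ rfl rfl rfl rfl rfl rfl
  refine ⟨Six (ZMod ℓ), inferInstance, a, b, c, ⟨1, 0, 0, 0, 0, 0⟩, ⟨0, 1, 0, 0, 0, 0⟩,
    ⟨0, 0, 1, 0, 0, 0⟩, ⟨?_, ?_, ?_⟩, ⟨x1, y1, z1⟩, ⟨?_, ?_, ?_⟩, ⟨?_, ?_, ?_⟩, x3, y3, z3⟩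
  · exact Equiv.ext fun v => ha v
  · exact Equiv.ext fun v => hb v
  · exact Equiv.ext fun v => hc v
  · rw [eb]; ext <;> simp [bf]
  · rw [ec]; ext <;> simp [cf]
  · rw [ea]; ext <;> simp [af]
  · rw [x2, ea]; ext <;> simp [af]
  · rw [y2, eb]; ext <;> simp [bf]
  · rw [z2, ec]; ext <;> simp [cf]

end FiniteRep

/-! ### Assembly -/

section Assembly

theorem lift_altWord {H : Type} [Group H] {V : Type} (f : V → H) (i j : V) (m : ℕ) :
    FreeGroup.lift f (altWord i j (2 * m + 1)) = (f i * f j) ^ m * f i := by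
  have h : ∀ k, FreeGroup.lift f (altWord i j (2 * k)) = (f i * f j) ^ k := by
    intro k
    induction k with
    | zero => simp [altWord]
    | succ k ih =>
      rw [pow_succ, ← ih]
      have : 2 * (k + 1) = 2 * k + 1 + 1 := by ring
      rw [this]
      unfold altWord
      rw [List.range_succ, List.range_succ]
      simp [mul_assoc]
  rw [← h]
  unfold altWord
  rw [List.range_succ]
  simp

theorem artin_lift {H : Type} [Group H] (m n p : ℕ) (a b c : H)
    (h1 : (a * b) ^ m * a = (b * a) ^ m * b) (h2 : (b * c) ^ n * b = (c * b) ^ n * c)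
    (h3 : (c * a) ^ p * c = (a * c) ^ p * a) :
    ∃ Ψ : Artin3 (2 * m + 1) (2 * n + 1) (2 * p + 1) →* H,
      Ψ (PresentedGroup.of 0) = a ∧ Ψ (PresentedGroup.of 1) = b ∧ Ψ (PresentedGroup.of 2) = c := by
  have hr : ∀ r ∈ artinRels3 (2 * m + 1) (2 * n + 1) (2 * p + 1),
      FreeGroup.lift ![a, b, c] r = 1 := by
    intro r hr
    simp only [artinRels3, Set.mem_insert_iff, Set.mem_singleton_iff] at hr
    rcases hr with rfl | rfl | rfl
    · rw [map_mul, map_inv, lift_altWord, lift_altWord, mul_inv_eq_one]; exact h1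
    · rw [map_mul, map_inv, lift_altWord, lift_altWord, mul_inv_eq_one]; exact h2
    · rw [map_mul, map_inv, lift_altWord, lift_altWord, mul_inv_eq_one]; exact h3
  exact ⟨PresentedGroup.toGroup hr, PresentedGroup.toGroup.of hr, PresentedGroup.toGroup.of hr,
    PresentedGroup.toGroup.of hr⟩

theorem artin_rel {M N P : ℕ} (r : FreeGroup (Fin 3)) (s : FreeGroup (Fin 3))
    (h : r * s⁻¹ ∈ artinRels3 M N P) :
    (FreeGroup.lift (PresentedGroup.of (rels := artinRels3 M N P))) r =
      (FreeGroup.lift (PresentedGroup.of (rels := artinRels3 M N P))) s := by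
  have e : FreeGroup.lift (PresentedGroup.of (rels := artinRels3 M N P)) =
      PresentedGroup.mk (artinRels3 M N P) := by
    apply FreeGroup.ext_hom
    intro i
    rw [FreeGroup.lift_apply_of]
    rfl
  rw [e]
  have := PresentedGroup.one_of_mem h
  rwa [map_mul, map_inv, mul_inv_eq_one] at this

theorem artin_rels (m n p : ℕ) :
    ∃ a b c : Artin3 (2 * m + 1) (2 * n + 1) (2 * p + 1),
      PresentedGroup.of 0 = a ∧ PresentedGroup.of 1 = b ∧ PresentedGroup.of 2 = c ∧
      (a * b) ^ m * a = (b * a) ^ m * b ∧ (b * c) ^ n * b = (c * b) ^ n * c ∧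
      (c * a) ^ p * c = (a * c) ^ p * a := by
  refine ⟨_, _, _, rfl, rfl, rfl, ?_, ?_, ?_⟩
  · have := artin_rel (M := 2 * m + 1) (N := 2 * n + 1) (P := 2 * p + 1) (altWord 0 1 (2 * m + 1))
      (altWord 1 0 (2 * m + 1)) (by simp [artinRels3])
    rwa [lift_altWord, lift_altWord] at this
  · have := artin_rel (M := 2 * m + 1) (N := 2 * n + 1) (P := 2 * p + 1) (altWord 1 2 (2 * n + 1))
      (altWord 2 1 (2 * n + 1)) (by simp [artinRels3])
    rwa [lift_altWord, lift_altWord] at this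
  · have := artin_rel (M := 2 * m + 1) (N := 2 * n + 1) (P := 2 * p + 1) (altWord 2 0 (2 * p + 1))
      (altWord 0 2 (2 * p + 1)) (by simp [artinRels3])
    rwa [lift_altWord, lift_altWord] at this

/-- Rotating an alternating word. -/
theorem rot_pow {H : Type} [Group H] (a b : H) (m : ℕ) : (a * b) ^ m * a = a * (b * a) ^ m := by
  induction m with
  | zero => simp
  | succ m ih => rw [pow_succ', mul_assoc, ih, pow_succ']; simp only [mul_assoc]

/-- The images of the seven generators. -/
def gens7 {H : Type} [Group H] (m n p : ℕ) (X Y Z : H) : Fin 7 → H :=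
  ![X ^ (2 * m + 1), (X ^ m)⁻¹ * Y, (X ^ (m + 1))⁻¹ * Y ^ n * X ^ m,
    (X ^ (m + 1))⁻¹ * Z ^ p * X ^ m, Z * (X ^ m)⁻¹, Y ^ n * Z⁻¹, Y⁻¹ * Z ^ p]

/-- The inclusion of the amalgamated subgroup. -/
def gam (m n p : ℕ) : FreeGroup (Fin 7) →* FreeGroup (Fin 3) :=
  FreeGroup.lift (gens7 m n p (FreeGroup.of 0) (FreeGroup.of 1) (FreeGroup.of 2))

/-- The twisting endomorphism of the amalgamated subgroup. -/
def bet : FreeGroup (Fin 7) →* FreeGroup (Fin 7) :=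
  FreeGroup.lift ![FreeGroup.of 0, FreeGroup.of 4, FreeGroup.of 5, FreeGroup.of 6,
    FreeGroup.of 0 * FreeGroup.of 1 * (FreeGroup.of 0)⁻¹,
    FreeGroup.of 0 * FreeGroup.of 2 * (FreeGroup.of 0)⁻¹,
    FreeGroup.of 0 * FreeGroup.of 3 * (FreeGroup.of 0)⁻¹]

theorem bet_bet (c : FreeGroup (Fin 7)) :
    bet (bet c) = FreeGroup.of 0 * c * (FreeGroup.of 0)⁻¹ := by
  have : bet.comp bet = (MulAut.conj (FreeGroup.of (0 : Fin 7))).toMonoidHom := by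
    apply FreeGroup.ext_hom
    intro i
    fin_cases i <;> simp [bet]
  have h := DFunLike.congr_fun this c
  simpa using h

theorem comp_gam {H : Type} [Group H] (m n p : ℕ) (j : FreeGroup (Fin 3) →* H) (i : Fin 7) :
    j (gam m n p (FreeGroup.of i)) =
      gens7 m n p (j (FreeGroup.of 0)) (j (FreeGroup.of 1)) (j (FreeGroup.of 2)) i := by
  unfold gam
  rw [FreeGroup.lift_apply_of]
  fin_cases i <;> simp [gens7]

theorem twist_all {H : Type} [Group H] (f : FreeGroup (Fin 7) →* H) (D : H)
    (hD : D * D = f (FreeGroup.of 0))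
    (h1 : D * f (FreeGroup.of 1) = f (FreeGroup.of 4) * D)
    (h2 : D * f (FreeGroup.of 2) = f (FreeGroup.of 5) * D)
    (h3 : D * f (FreeGroup.of 3) = f (FreeGroup.of 6) * D) (c : FreeGroup (Fin 7)) :
    D * f c = f (bet c) * D := by
  have aux : ∀ u v : H, D * u = v * D → D * v * D⁻¹ = D * D * u * (D * D)⁻¹ := by
    intro u v h
    rw [eq_mul_inv_iff_mul_eq, mul_assoc D D u, h]; group
  have : (MulAut.conj D).toMonoidHom.comp f = f.comp bet := by
    apply FreeGroup.ext_hom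
    intro i
    fin_cases i
    · simp only [bet, MonoidHom.comp_apply, MulEquiv.coe_toMonoidHom, MulAut.conj_apply]
      simp [← hD, mul_assoc]
    · simp [bet, h1]
    · simp [bet, h2]
    · simp [bet, h3]
    · simpa [bet, ← hD] using aux _ _ h1
    · simpa [bet, ← hD] using aux _ _ h2
    · simpa [bet, ← hD] using aux _ _ h3
  have h := DFunLike.congr_fun this c
  simp only [MonoidHom.comp_apply, MulEquiv.coe_toMonoidHom, MulAut.conj_apply] at h
  rw [← h]; group

theorem fwd_rel {H : Type} [Group H] (m n p : ℕ) (a b c : H)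
    (r1 : (a * b) ^ m * a = (b * a) ^ m * b) (r2 : (b * c) ^ n * b = (c * b) ^ n * c)
    (r3 : (c * a) ^ p * c = (a * c) ^ p * a) (D : H) (hD : D = a * (b * a) ^ m)
    (g : Fin 7 → H) (hg : g = gens7 m n p (b * a) (c * b) (a * c)) :
    D * D = g 0 ∧ D * g 1 = g 4 * D ∧ D * g 2 = g 5 * D ∧ D * g 3 = g 6 * D := by
  rw [rot_pow] at r1 r2 r3
  have hD2 : D = (b * a) ^ m * b := hD.trans r1
  have hDx : D * ((b * a) ^ m)⁻¹ = a := by rw [hD]; group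
  have hDx1 : D * ((b * a) ^ (m + 1))⁻¹ = b⁻¹ := by rw [hD, pow_succ']; group
  subst hg
  simp only [gens7, Matrix.cons_val]
  refine ⟨?_, ?_, ?_, ?_⟩
  · calc D * D = ((b * a) ^ m * b) * (a * (b * a) ^ m) := by rw [← hD2, ← hD]
      _ = (b * a) ^ m * ((b * a) * (b * a) ^ m) := by simp only [mul_assoc]
      _ = (b * a) ^ (2 * m + 1) := by rw [← pow_succ', ← pow_add]; congr 1; ring
  · rw [← mul_assoc, hDx]
    conv_rhs => rw [hD2]
    group
  · rw [← mul_assoc, ← mul_assoc, hDx1]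
    conv_rhs => rw [hD]
    have : b⁻¹ * (c * b) ^ n = (c * b) ^ n * c⁻¹ := by
      rw [inv_mul_eq_iff_eq_mul, ← mul_assoc, r2]; group
    rw [this]; group
  · rw [← mul_assoc, ← mul_assoc, hDx1]
    conv_rhs => rw [hD]
    have : (a * c) ^ p = c⁻¹ * (a * c) ^ p * a := by
      rw [mul_assoc, eq_inv_mul_iff_mul_eq, r3]
    conv_lhs => rw [this]
    group

theorem bwd_rel {H : Type} [Group H] (m n p : ℕ) (X Y Z D : H)
    (g : Fin 7 → H) (hg : g = gens7 m n p X Y Z)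
    (h0 : D * D = g 0) (h1 : D * g 1 = g 4 * D) (h2 : D * g 2 = g 5 * D)
    (h3 : D * g 3 = g 6 * D) :
    ∃ a b c : H, b * a = X ∧ c * b = Y ∧ a * c = Z ∧ a * (b * a) ^ m = D ∧
      (a * b) ^ m * a = (b * a) ^ m * b ∧ (b * c) ^ n * b = (c * b) ^ n * c ∧
      (c * a) ^ p * c = (a * c) ^ p * a := by
  subst hg
  simp only [gens7, Matrix.cons_val] at h0 h1 h2 h3
  obtain ⟨a, ha⟩ : ∃ a, a = D * (X ^ m)⁻¹ := ⟨_, rfl⟩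
  obtain ⟨b, hb⟩ : ∃ b, b = (X ^ m)⁻¹ * D := ⟨_, rfl⟩
  obtain ⟨c, hc⟩ : ∃ c, c = Y * b⁻¹ := ⟨_, rfl⟩
  have eX : b * a = X := by
    have : b * a = (X ^ m)⁻¹ * (D * D) * (X ^ m)⁻¹ := by rw [ha, hb]; group
    rw [this, h0]; group
  have eY : c * b = Y := by rw [hc]; group
  have hDa : D = a * X ^ m := by rw [ha]; group
  have hDb : D = X ^ m * b := by rw [hb]; group
  have eZ : a * c = Z := by
    have e1 : a * Y = Z * b := by
      rw [ha, hb, mul_assoc, h1]; group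
    rw [hc, ← mul_assoc, e1]; group
  have hDx1 : D * (X ^ (m + 1))⁻¹ = b⁻¹ := by
    rw [hDa, pow_succ', ← eX]; group
  refine ⟨a, b, c, eX, eY, eZ, by rw [eX, hDa], ?_, ?_, ?_⟩
  · rw [rot_pow, eX, ← hDa, hDb]
  · rw [rot_pow, eY]
    rw [← mul_assoc, ← mul_assoc, hDx1] at h2
    conv_rhs at h2 => rw [hDa, ← eZ]
    have e2 : b⁻¹ * Y ^ n = Y ^ n * c⁻¹ := by
      apply mul_right_cancel (b := X ^ m)
      rw [h2]; group
    rw [inv_mul_eq_iff_eq_mul, ← mul_assoc, eq_mul_inv_iff_mul_eq] at e2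
    exact e2.symm
  · rw [rot_pow, eZ]
    rw [← mul_assoc, ← mul_assoc, hDx1] at h3
    conv_rhs at h3 => rw [hDa, ← eY]
    have e2 : Z ^ p = c⁻¹ * Z ^ p * a := by
      apply mul_right_cancel (b := X ^ m)
      apply mul_left_cancel (a := b⁻¹)
      rw [← mul_assoc, h3]; group
    rw [mul_assoc, eq_inv_mul_iff_mul_eq] at e2
    exact e2

theorem fix_range {V : Type} (m n p : ℕ) (x y z : Equiv.Perm V) (v0 vp vq : V)
    (hx : x ^ (2 * m + 1) = 1) (hy : y ^ (2 * n + 1) = 1) (hz : z ^ (2 * p + 1) = 1)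
    (x1 : (x ^ m) v0 = vp) (x2 : x vp = vq) (y1 : y v0 = vp) (y2 : (y ^ n) vq = v0)
    (z1 : z vq = v0) (z2 : (z ^ p) vp = vq) (i : Fin 7) : gens7 m n p x y z i v0 = v0 := by
  have x3 : (x ^ (m + 1)) v0 = vq := by rw [pow_succ', Equiv.Perm.mul_apply, x1, x2]
  have x4 : (x ^ m) vq = v0 := by
    rw [← x3, ← Equiv.Perm.mul_apply, ← pow_add]
    have : m + (m + 1) = 2 * m + 1 := by ring
    rw [this, hx]; rfl
  have y3 : (y ^ n) vp = vq := by
    have e : (y ^ n) (y ((y ^ n) vq)) = vq := by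
      rw [← Equiv.Perm.mul_apply, ← Equiv.Perm.mul_apply, ← pow_succ, ← pow_add]
      have : n + 1 + n = 2 * n + 1 := by ring
      rw [this, hy]; rfl
    rwa [y2, y1] at e
  have z3 : (z ^ p) v0 = vp := by
    have e : (z ^ p) (z ((z ^ p) vp)) = vp := by
      rw [← Equiv.Perm.mul_apply, ← Equiv.Perm.mul_apply, ← pow_succ, ← pow_add]
      have : p + 1 + p = 2 * p + 1 := by ring
      rw [this, hz]; rfl
    rwa [z2, z1] at e
  fin_cases i
  · simp [gens7, hx]
  · simp only [gens7, Fin.mk_one, Matrix.cons_val, Equiv.Perm.mul_apply]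
    rw [Equiv.Perm.inv_eq_iff_eq, y1, x1]
  · simp only [gens7, Fin.reduceFinMk, Matrix.cons_val, Equiv.Perm.mul_apply]
    rw [Equiv.Perm.inv_eq_iff_eq, x1, y3, x3]
  · simp only [gens7, Fin.reduceFinMk, Matrix.cons_val, Equiv.Perm.mul_apply]
    rw [Equiv.Perm.inv_eq_iff_eq, x1, z2, x3]
  · simp only [gens7, Fin.reduceFinMk, Matrix.cons_val, Equiv.Perm.mul_apply]
    have : (x ^ m)⁻¹ v0 = vq := by rw [Equiv.Perm.inv_eq_iff_eq, x4]
    rw [this, z1]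
  · simp only [gens7, Fin.reduceFinMk, Matrix.cons_val, Equiv.Perm.mul_apply]
    have : z⁻¹ v0 = vq := by rw [Equiv.Perm.inv_eq_iff_eq, z1]
    rw [this, y2]
  · simp only [gens7, Fin.reduceFinMk, Matrix.cons_val, Equiv.Perm.mul_apply]
    rw [Equiv.Perm.inv_eq_iff_eq, z3, y1]

theorem perm_braid {H : Type} [Group H] (m : ℕ) (a b : H) (ha : a * a = 1) (hb : b * b = 1)
    (h : (b * a) ^ (2 * m + 1) = 1) : (a * b) ^ m * a = (b * a) ^ m * b := by
  have e : a * b = (b * a)⁻¹ := by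
    rw [mul_inv_rev, inv_eq_of_mul_eq_one_left ha, inv_eq_of_mul_eq_one_left hb]
  rw [e, inv_pow, inv_mul_eq_iff_eq_mul, ← mul_assoc, ← pow_add, ← two_mul]
  rw [pow_succ, ← mul_assoc] at h
  have := eq_inv_of_mul_eq_one_left h
  rw [this, inv_eq_of_mul_eq_one_left ha]

theorem retract_exists {Q : Type} [Group Q] (m n p : ℕ) (hm : 2 ≤ m) (hn : 2 ≤ n) (hp : 2 ≤ p)
    (φ : FreeGroup (Fin 3) →* Q)
    (h0 : ∀ i, 0 < i → i < 2 * m + 1 →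
      φ (FreeGroup.of 0) ^ i ∉ (φ.comp (gam m n p)).range)
    (h1 : ∀ i, 0 < i → i < 2 * n + 1 →
      φ (FreeGroup.of 1) ^ i ∉ (φ.comp (gam m n p)).range)
    (h2 : ∀ i, 0 < i → i < 2 * p + 1 →
      φ (FreeGroup.of 2) ^ i ∉ (φ.comp (gam m n p)).range) :
    ∃ ρ : φ.ker →* FreeGroup (Fin 7), (∀ k, φ (gam m n p (ρ k)) = 1) ∧
      ∀ c (h : gam m n p c ∈ φ.ker), ρ ⟨gam m n p c, h⟩ = c := by
  let o : Fin 7 → FreeGroup (Fin 7) := FreeGroup.of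
  let E6 := o 4 * o 0
  let E3 := o 5 * E6
  let E4 := o 1 * o 6
  let g0 : ℕ → FreeGroup (Fin 7) := fun j => if j = 2 * m + 1 then o 0 else 1
  let g1 : ℕ → FreeGroup (Fin 7) := fun j => if j = 1 then o 1 else
    if j = n + 1 then o 2 * o 1 else if j = 2 * n + 1 then E3 * (o 2 * o 1) else 1
  let g2 : ℕ → FreeGroup (Fin 7) := fun j => if j = p then E4 else
    if j = 2 * p then o 3 * E4 else if j = 2 * p + 1 then E6 * (o 3 * E4) else 1
  let g : Fin 3 → ℕ → FreeGroup (Fin 7) := ![g0, g1, g2]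
  let L : Fin 3 → ℕ := ![2 * m + 1, 2 * n + 1, 2 * p + 1]
  have hγ : ∀ i, gam m n p (o i) =
      gens7 m n p (FreeGroup.of 0) (FreeGroup.of 1) (FreeGroup.of 2) i := fun i => by
    simp only [gam, o, FreeGroup.lift_apply_of]
  have c0 : gam m n p (o 0) = FreeGroup.of 0 ^ (2 * m + 1) := hγ 0
  have c1 : gam m n p (o 1) = (FreeGroup.of 0 ^ m)⁻¹ * FreeGroup.of 1 := hγ 1
  have c2 : gam m n p (o 2) = (FreeGroup.of 0 ^ (m + 1))⁻¹ * FreeGroup.of 1 ^ n *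
    FreeGroup.of 0 ^ m := hγ 2
  have c3 : gam m n p (o 3) = (FreeGroup.of 0 ^ (m + 1))⁻¹ * FreeGroup.of 2 ^ p *
    FreeGroup.of 0 ^ m := hγ 3
  have c4 : gam m n p (o 4) = FreeGroup.of 2 * (FreeGroup.of 0 ^ m)⁻¹ := hγ 4
  have c5 : gam m n p (o 5) = FreeGroup.of 1 ^ n * (FreeGroup.of 2)⁻¹ := hγ 5
  have c6 : gam m n p (o 6) = (FreeGroup.of 1)⁻¹ * FreeGroup.of 2 ^ p := hγ 6
  have d21 : gam m n p (o 2 * o 1) = (FreeGroup.of 0 ^ (m + 1))⁻¹ * FreeGroup.of 1 ^ (n + 1) := by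
    rw [map_mul, c2, c1, pow_succ (FreeGroup.of 1)]; group
  have dE4 : gam m n p E4 = (FreeGroup.of 0 ^ m)⁻¹ * FreeGroup.of 2 ^ p := by
    simp only [E4]; rw [map_mul, c1, c6]; group
  have dE34 : gam m n p (o 3 * E4) = (FreeGroup.of 0 ^ (m + 1))⁻¹ * FreeGroup.of 2 ^ (2 * p) := by
    rw [map_mul, c3, dE4, two_mul, pow_add (FreeGroup.of 2)]; group
  have dE6 : gam m n p E6 = FreeGroup.of 2 * FreeGroup.of 0 ^ (m + 1) := by
    have : 2 * m + 1 = m + (m + 1) := by ring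
    simp only [E6]; rw [map_mul, c4, c0, this, pow_add _ m (m + 1)]; group
  have dE3 : gam m n p E3 = FreeGroup.of 1 ^ n * FreeGroup.of 0 ^ (m + 1) := by
    simp only [E3]; rw [map_mul, c5, dE6]; group
  have dE6' : gam m n p (E6 * (o 3 * E4)) = FreeGroup.of 2 ^ (2 * p + 1) := by
    rw [map_mul, dE6, dE34, pow_succ' _ (2 * p)]; group
  have dE3' : gam m n p (E3 * (o 2 * o 1)) = FreeGroup.of 1 ^ (2 * n + 1) := by
    have : 2 * n + 1 = n + (n + 1) := by ring
    rw [map_mul, dE3, d21, this, pow_add _ n (n + 1)]; group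
  apply exists_retraction (gam m n p) φ L g
  · intro s
    fin_cases s
    · simp [g, g0]
    · have : n + 1 ≠ 0 := by omega
      simp [g, g1]
    · have : p ≠ 0 := by omega
      simp [g, g2, this.symm]
      omega
  · intro i hi
    have : i ≠ 2 * m + 1 := by
      have : i < 2 * m + 1 := hi
      omega
    simp [g, g0, this]
  · intro s i hi hl
    fin_cases s
    · exact h0 i hi hl
    · exact h1 i hi hl
    · exact h2 i hi hl
  · set S := {u : FreeGroup (Fin 7) | ∃ s j i, j ≤ L s ∧ i < L 0 ∧ g s j = u ∧
      gam m n p u = (FreeGroup.of 0 ^ i)⁻¹ * FreeGroup.of s ^ j} with hS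
    have m0 : o 0 ∈ S := ⟨0, 2 * m + 1, 0, le_refl _, by simp [L], by simp [g, g0],
      by rw [c0]; simp⟩
    have m1 : o 1 ∈ S := ⟨1, 1, m, by simp [L], by simp [L]; omega, by simp [g, g1],
      by rw [c1]; simp⟩
    have m2 : o 2 * o 1 ∈ S := ⟨1, n + 1, m + 1, by simp [L]; omega, by simp [L]; omega, by
      have : n ≠ 0 := by omega
      simp [g, g1, this], d21⟩
    have m3 : E3 * (o 2 * o 1) ∈ S := ⟨1, 2 * n + 1, 0, by simp [L], by simp [L], by
      have h1 : n ≠ 0 := by omega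
      have h2 : 2 * n ≠ n := by omega
      simp [g, g1, h1, h2], by rw [dE3']; simp⟩
    have m4 : E4 ∈ S := ⟨2, p, m, by simp [L]; omega, by simp [L]; omega, by simp [g, g2], dE4⟩
    have m5 : o 3 * E4 ∈ S := ⟨2, 2 * p, m + 1, by simp [L], by simp [L]; omega, by
      have h1 : p ≠ 0 := by omega
      have h2 : 2 * p ≠ p := by omega
      simp only [g, g2, Matrix.cons_val, h2, if_false, if_true], dE34⟩
    have m6 : E6 * (o 3 * E4) ∈ S := ⟨2, 2 * p + 1, 0, by simp [L], by simp [L], by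
      have h1 : 2 * p + 1 ≠ 2 * p := by omega
      have h2 : 2 * p + 1 ≠ p := by omega
      simp only [g, g2, Matrix.cons_val, h1, h2, if_false, if_true], by rw [dE6']; simp⟩
    have k0 := Subgroup.subset_closure m0
    have k1 := Subgroup.subset_closure m1
    have k21 := Subgroup.subset_closure m2
    have k321 := Subgroup.subset_closure m3
    have k4 := Subgroup.subset_closure m4
    have k54 := Subgroup.subset_closure m5
    have k654 := Subgroup.subset_closure m6
    have q2 : o 2 ∈ Subgroup.closure S := (Subgroup.mul_mem_cancel_right _ k1).mp k21
    have q3 : o 3 ∈ Subgroup.closure S := (Subgroup.mul_mem_cancel_right _ k4).mp k54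
    have qE3 : E3 ∈ Subgroup.closure S := (Subgroup.mul_mem_cancel_right _ k21).mp k321
    have qE6 : E6 ∈ Subgroup.closure S := (Subgroup.mul_mem_cancel_right _ k54).mp k654
    have q4 : o 4 ∈ Subgroup.closure S := (Subgroup.mul_mem_cancel_right _ k0).mp qE6
    have q5 : o 5 ∈ Subgroup.closure S := (Subgroup.mul_mem_cancel_right _ qE6).mp qE3
    have q6 : o 6 ∈ Subgroup.closure S := (Subgroup.mul_mem_cancel_left _ k1).mp k4
    rw [eq_top_iff, ← FreeGroup.closure_range_of, Subgroup.closure_le]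
    rintro _ ⟨i, rfl⟩
    fin_cases i
    · exact k0
    · exact k1
    · exact q2
    · exact q3
    · exact q4
    · exact q5
    · exact q6

theorem artin3_odd_rf (m n p : ℕ) (hm : 2 ≤ m) (hn : 2 ≤ n) (hp : 2 ≤ p) :
    ResiduallyFinite (Artin3 (2 * m + 1) (2 * n + 1) (2 * p + 1)) := by
  obtain ⟨a, b, c, ea, eb, ec, r1, r2, r3⟩ := artin_rels m n p
  let ι : FreeGroup (Fin 3) →* Artin3 (2 * m + 1) (2 * n + 1) (2 * p + 1) :=
    FreeGroup.lift ![b * a, c * b, a * c]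
  have i0 : ι (FreeGroup.of 0) = b * a := by simp [ι]
  have i1 : ι (FreeGroup.of 1) = c * b := by simp [ι]
  have i2 : ι (FreeGroup.of 2) = a * c := by simp [ι]
  obtain ⟨δ, hδ⟩ : ∃ δ, δ = a * (b * a) ^ m := ⟨_, rfl⟩
  have hgamι : ∀ i, ι (gam m n p (FreeGroup.of i)) = gens7 m n p (b * a) (c * b) (a * c) i := by
    intro i; rw [comp_gam, i0, i1, i2]
  obtain ⟨f0, f1, f2, f3⟩ := fwd_rel m n p a b c r1 r2 r3 δ hδ _ rfl
  rw [← hgamι] at f0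
  rw [← hgamι, ← hgamι] at f1 f2 f3
  have htw : ∀ c, δ * ι (gam m n p c) = ι (gam m n p (bet c)) * δ :=
    twist_all (ι.comp (gam m n p)) δ f0 f1 f2 f3
  -- finite representation
  obtain ⟨V, hV, pa, pb, pc, v0, vp, vq, ⟨ia, ib, ic⟩, ⟨ox, oy, oz⟩, ⟨t1, t2, t3⟩, ⟨s1, s2, s3⟩,
    n1, n2, n3⟩ := exists_finite_rep m n p hm hn hp
  obtain ⟨Φ, Φa, Φb, Φc⟩ := artin_lift m n p pa pb pc (perm_braid m pa pb ia ib ox)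
    (perm_braid n pb pc ib ic oy) (perm_braid p pc pa ic ia oz)
  rw [ea] at Φa
  rw [eb] at Φb
  rw [ec] at Φc
  let φ : FreeGroup (Fin 3) →* Equiv.Perm V := Φ.comp ι
  have p0 : φ (FreeGroup.of 0) = pb * pa := by
    show Φ (ι _) = _
    rw [i0, map_mul, Φa, Φb]
  have p1 : φ (FreeGroup.of 1) = pc * pb := by
    show Φ (ι _) = _
    rw [i1, map_mul, Φc, Φb]
  have p2 : φ (FreeGroup.of 2) = pa * pc := by
    show Φ (ι _) = _
    rw [i2, map_mul, Φa, Φc]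
  have hfix : ∀ r ∈ (φ.comp (gam m n p)).range, r v0 = v0 := by
    rintro _ ⟨c, rfl⟩
    have hle : (⊤ : Subgroup (FreeGroup (Fin 7))) ≤
        (MulAction.stabilizer (Equiv.Perm V) v0).comap (φ.comp (gam m n p)) := by
      rw [← FreeGroup.closure_range_of, Subgroup.closure_le]
      rintro _ ⟨i, rfl⟩
      show φ (gam m n p (FreeGroup.of i)) v0 = v0
      rw [comp_gam, p0, p1, p2]
      refine fix_range m n p _ _ _ v0 vp vq ox oy oz s1 ?_ ?_ s2 ?_ s3 i
      · rw [Equiv.Perm.mul_apply, t3, t1]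
      · rw [Equiv.Perm.mul_apply, t1, t2]
      · rw [Equiv.Perm.mul_apply, t2, t3]
    exact hle (Subgroup.mem_top c)
  have orb : ∀ (w : Equiv.Perm V) (k : ℕ) (o : V), (w ^ k) o = v0 → ∀ i, (w ^ i) v0 = v0 →
      (w ^ i) o = o := by
    intro w k o ho i hi
    apply (w ^ k).injective
    rw [← Equiv.Perm.mul_apply, ← pow_add, add_comm, pow_add, Equiv.Perm.mul_apply, ho, hi]
  obtain ⟨ρ, hρ1, hρ2⟩ := retract_exists m n p hm hn hp φ
    (fun i h1 h2 h3 => by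
      rw [p0] at h3
      exact absurd (Nat.le_of_dvd h1 (n1 i (hfix _ h3))) (by omega))
    (fun i h1 h2 h3 => by
      rw [p1] at h3
      exact absurd (Nat.le_of_dvd h1 (n2 i (orb _ n vq s2 i (hfix _ h3)))) (by omega))
    (fun i h1 h2 h3 => by
      rw [p2] at h3
      have hz : ((pa * pc) ^ (p + 1)) vp = v0 := by
        rw [pow_succ', Equiv.Perm.mul_apply, s3, Equiv.Perm.mul_apply, t2, t3]
      exact absurd (Nat.le_of_dvd h1 (n3 i (orb _ (p + 1) vp hz i (hfix _ h3)))) (by omega))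
  have hβ : ∀ c, φ (gam m n p c) = 1 → φ (gam m n p (bet c)) = 1 := by
    intro c hc
    have h := congrArg Φ (htw c)
    rw [map_mul, map_mul] at h
    have hc' : Φ (ι (gam m n p c)) = 1 := hc
    rw [hc', mul_one] at h
    exact (right_eq_mul.mp h)
  refine rf_criterion ι (gam m n p) bet (FreeGroup.of 0) δ (by simp [bet]) bet_bet f0 htw ?_ ?_ ?_
  · -- generation
    set S := Subgroup.closure (Set.range ι ∪ {δ}) with hS
    have hι : ∀ w, ι w ∈ S := fun w => Subgroup.subset_closure (Or.inl ⟨w, rfl⟩)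
    have hδm : δ ∈ S := Subgroup.subset_closure (Or.inr rfl)
    have hx : b * a ∈ S := i0 ▸ hι _
    have hy : c * b ∈ S := i1 ▸ hι _
    have ha : a ∈ S := by
      rw [hδ] at hδm
      exact (Subgroup.mul_mem_cancel_right _ (pow_mem hx m)).mp hδm
    have hb : b ∈ S := (Subgroup.mul_mem_cancel_right _ ha).mp hx
    have hc : c ∈ S := (Subgroup.mul_mem_cancel_right _ hb).mp hy
    rw [eq_top_iff, ← PresentedGroup.closure_range_of, Subgroup.closure_le]
    rintro _ ⟨i, rfl⟩
    fin_cases i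
    · exact ea ▸ ha
    · exact eb ▸ hb
    · exact ec ▸ hc
  · -- universal property
    intro H _ j D hD hDj
    have hD0 := hD
    rw [comp_gam] at hD0
    have hD1 := hDj (FreeGroup.of 1)
    have hD2 := hDj (FreeGroup.of 2)
    have hD3 := hDj (FreeGroup.of 3)
    have b1 : bet (FreeGroup.of 1) = FreeGroup.of 4 := by simp [bet]
    have b2 : bet (FreeGroup.of 2) = FreeGroup.of 5 := by simp [bet]
    have b3 : bet (FreeGroup.of 3) = FreeGroup.of 6 := by simp [bet]
    rw [b1, comp_gam, comp_gam] at hD1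
    rw [b2, comp_gam, comp_gam] at hD2
    rw [b3, comp_gam, comp_gam] at hD3
    obtain ⟨a', b', c', g1, g2, g3, g4, g5, g6, g7⟩ := bwd_rel m n p _ _ _ D _ rfl hD0 hD1 hD2 hD3
    obtain ⟨Ψ, Ψa, Ψb, Ψc⟩ := artin_lift m n p a' b' c' g5 g6 g7
    rw [ea] at Ψa
    rw [eb] at Ψb
    rw [ec] at Ψc
    refine ⟨Ψ, ?_, ?_⟩
    · have : Ψ.comp ι = j := by
        apply FreeGroup.ext_hom
        intro i
        fin_cases i
        · show Ψ (ι (FreeGroup.of 0)) = j (FreeGroup.of 0)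
          rw [i0, map_mul, Ψa, Ψb, g1]
        · show Ψ (ι (FreeGroup.of 1)) = j (FreeGroup.of 1)
          rw [i1, map_mul, Ψc, Ψb, g2]
        · show Ψ (ι (FreeGroup.of 2)) = j (FreeGroup.of 2)
          rw [i2, map_mul, Ψa, Ψc, g3]
      intro w
      exact DFunLike.congr_fun this w
    · rw [hδ, map_mul, map_pow, map_mul, Ψa, Ψb, g4]
  · -- separation
    intro S hS a₀
    exact sep_of_retract freeGroup_rf (gam m n p) bet φ hβ ρ hρ1 hρ2 S hS a₀

end Assembly

theorem artin3_allOdd_residuallyFinite (M N P : ℕ) (hM : 5 ≤ M) (hN : 5 ≤ N) (hP : 5 ≤ P)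
    (hMo : Odd M) (hNo : Odd N) (hPo : Odd P) :
    ResiduallyFinite (Artin3 M N P) := by
  obtain ⟨m, rfl⟩ := hMo
  obtain ⟨n, rfl⟩ := hNo
  obtain ⟨p, rfl⟩ := hPo
  exact artin3_odd_rf m n p (by omega) (by omega) (by omega)
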